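/- Let p be a prime, let m and n be positive integers with m ≤ n, and let ℓ₁ and ℓ₂ be positive definite even integral quadratic forms of rank m. Then the following are equivalent: (i) there exists a symmetric matrix L ∈ M_n(ℤ_p) with det L ≠ 0 and matrices T₁, T₂ ∈ M_{n×m}(ℤ_p) such that T_iᵀ L T_i = ℓ_i for i = 1,2 (the pair is buried in rank n over ℤ_p); (ii) there exists a symmetric matrix V ∈ M_n(ℚ_p) with det V ≠ 0 and matrices S₁, S₂ ∈ M_{n×m}(ℚ_p) such that S_iᵀ V S_i = ℓ_i for i = 1,2 (the pair is buried in rank n over ℚ_p); (iii) either ℓ₁ and ℓ₂ are equivalent over ℚ_p (there is an invertible U ∈ M_m(ℚ_p) with Uᵀ ℓ₁ U = ℓ₂), or det ℓ₁ · det ℓ₂ is not a square in ℚ_p and n = m+1, or n ≥ m+2. -/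

import Mathlib

open Matrix

/-- A positive definite integral quadratic form of rank `m`. -/
def IsPDForm {m : ℕ} (M : Matrix (Fin m) (Fin m) ℤ) : Prop :=
  M.IsSymm ∧ ∀ x : Fin m → ℤ, x ≠ 0 → 0 < x ⬝ᵥ M.mulVec x

/-- `N` is represented by `L` if `Tᵀ L T = N` for some integer matrix `T`. -/
def Represents {n m : ℕ} (L : Matrix (Fin n) (Fin n) ℤ)
    (N : Matrix (Fin m) (Fin m) ℤ) : Prop :=
  ∃ T : Matrix (Fin n) (Fin m) ℤ, Tᵀ * L * T = N

/-- An integer `a` is represented by the form `M`. -/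
def RepresentsInt {m : ℕ} (M : Matrix (Fin m) (Fin m) ℤ) (a : ℤ) : Prop :=
  ∃ x : Fin m → ℤ, x ⬝ᵥ M.mulVec x = a

/-- Two integral forms of rank `n` are isometric. -/
def IsomForm {n : ℕ} (A B : Matrix (Fin n) (Fin n) ℤ) : Prop :=
  ∃ U : Matrix (Fin n) (Fin n) ℤ, IsUnit U.det ∧ Uᵀ * A * U = B


/-- An integral form is even if it takes only even values. -/
def IsEvenForm {m : ℕ} (M : Matrix (Fin m) (Fin m) ℤ) : Prop :=
  ∀ x : Fin m → ℤ, 2 ∣ x ⬝ᵥ M.mulVec x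

/-- The pair (ℓ₁, ℓ₂) of integral forms of rank m is buried in rank n over the
commutative ring R: some nondegenerate symmetric n×n matrix over R represents
both ℓ₁ and ℓ₂ over R. -/
def BuriedIn (R : Type*) [CommRing R] {m : ℕ} (n : ℕ)
    (ℓ₁ ℓ₂ : Matrix (Fin m) (Fin m) ℤ) : Prop :=
  ∃ L : Matrix (Fin n) (Fin n) R, L.IsSymm ∧ L.det ≠ 0 ∧
    (∃ T : Matrix (Fin n) (Fin m) R, Tᵀ * L * T = ℓ₁.map (Int.cast : ℤ → R)) ∧
    (∃ T : Matrix (Fin n) (Fin m) R, Tᵀ * L * T = ℓ₂.map (Int.cast : ℤ → R))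

namespace Bur

section padic
variable {p : ℕ} [Fact p.Prime]

lemma norm_two_le : ‖(2 : ℚ_[p])‖ ≤ 1 := by
  have := Padic.norm_int_le_one (p := p) 2
  simpa using this

lemma norm_four : ‖(4 : ℚ_[p])‖ = ‖(2 : ℚ_[p])‖ * ‖(2 : ℚ_[p])‖ := by
  rw [← norm_mul]; norm_num

lemma norm_four_le : ‖(4 : ℚ_[p])‖ ≤ 1 := by
  rw [norm_four]; nlinarith [norm_two_le (p := p), norm_nonneg (2 : ℚ_[p])]

lemma norm_two_pos : 0 < ‖(2 : ℚ_[p])‖ := norm_pos_iff.2 (by norm_num)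

lemma nonarch (x y : ℚ_[p]) (r : ℝ) (hx : ‖x‖ ≤ r) (hy : ‖y‖ ≤ r) : ‖x + y‖ ≤ r :=
  (Padic.nonarchimedean x y).trans (max_le hx hy)

lemma sq_of_near (u : ℚ_[p]) (h : ‖1 - u‖ < ‖(4 : ℚ_[p])‖) : IsSquare u := by
  have hu : ‖u‖ ≤ 1 := by
    have : u = 1 + -(1 - u) := by ring
    rw [this]
    apply nonarch
    · simp
    · rw [norm_neg]; exact h.le.trans norm_four_le
  obtain ⟨u, rfl⟩ : ∃ v : ℤ_[p], (v : ℚ_[p]) = u := ⟨⟨u, hu⟩, rfl⟩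
  have := hensels_lemma (p := p) (R := ℤ_[p]) (F := Polynomial.X ^ 2 - Polynomial.C u) (a := 1) (by
    simp only [map_sub, map_pow, Polynomial.aeval_X, Polynomial.aeval_C, Polynomial.derivative_X_pow,
      Polynomial.derivative_C, Polynomial.derivative_sub, map_mul, map_one]
    simp
    have e1 : ‖1 - u‖ = ‖(1 : ℚ_[p]) - u‖ := by
      rw [← PadicInt.coe_one, ← PadicInt.coe_sub]; rfl
    have e2 : ‖(2 : ℤ_[p])‖ = ‖(2 : ℚ_[p])‖ := by
      rw [PadicInt.norm_def]; rfl
    rw [e1, e2, sq, ← norm_four]; exact h)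
  obtain ⟨z, hz, -⟩ := this
  simp at hz
  refine ⟨z, ?_⟩
  have : u = z * z := by linear_combination -hz
  rw [this]; push_cast; rfl

lemma hens (a x s : ℚ_[p]) (h1 : ‖a * x ^ 2‖ = 1) (h : ‖a * x ^ 2 + s‖ < ‖(4 : ℚ_[p])‖) :
    ∃ r, r ≠ 0 ∧ a * r ^ 2 + s = 0 := by
  have hne : a * x ^ 2 ≠ 0 := by intro h0; rw [h0] at h1; simp at h1
  have hs : ‖1 - (-s / (a * x ^ 2))‖ < ‖(4 : ℚ_[p])‖ := by
    have : 1 - (-s / (a * x ^ 2)) = (a * x ^ 2 + s) / (a * x ^ 2) := by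
      rw [eq_div_iff hne, sub_mul, div_mul_cancel₀ _ hne]; ring
    rw [this, norm_div, h1, div_one]; exact h
  obtain ⟨t, ht⟩ := sq_of_near _ hs
  have hx : x ≠ 0 := by rintro rfl; simp at hne
  have ha : a ≠ 0 := by rintro rfl; simp at hne
  have ht0 : t ≠ 0 := by
    rintro rfl
    rw [ht] at hs; simp at hs
    exact absurd hs (not_lt.2 norm_four_le)
  refine ⟨x * t, mul_ne_zero hx ht0, ?_⟩
  rw [div_eq_iff hne] at ht
  linear_combination -ht

lemma p_ne : (p : ℚ_[p]) ≠ 0 := by exact_mod_cast (Fact.out : p.Prime).ne_zero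

lemma val_p_mul_unit (u : ℚ_[p]) (hu : ‖u‖ = 1) : ¬ IsSquare ((p : ℚ_[p]) * u) := by
  have hu0 : u ≠ 0 := by intro h0; rw [h0] at hu; simp at hu
  rintro ⟨r, hr⟩
  have hr0 : r ≠ 0 := by
    rintro rfl
    rw [mul_zero] at hr
    exact mul_ne_zero p_ne hu0 hr
  have h1 : ‖(p : ℚ_[p]) * u‖ = (p : ℝ) ^ (-1 : ℤ) := by rw [norm_mul, hu]; simp
  have hp1 : (1 : ℝ) < p := by exact_mod_cast (Fact.out : p.Prime).one_lt
  rw [hr, norm_mul, Padic.norm_eq_zpow_neg_valuation hr0, ← zpow_add₀ (by positivity)] at h1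
  have := zpow_right_injective₀ (by positivity) hp1.ne' h1
  omega

lemma not_sq_p : ¬ IsSquare (p : ℚ_[p]) := by
  have := val_p_mul_unit (p := p) 1 (by simp)
  simpa using this

/-- normal form of a square class -/
lemma normal_form (a : ℚ_[p]) (ha : a ≠ 0) : ∃ s u : ℚ_[p], s ≠ 0 ∧ ‖u‖ = 1 ∧
    (a = u * s ^ 2 ∨ a = (p * u) * s ^ 2) := by
  have hp0 := p_ne (p := p)
  have hp1 : (0 : ℝ) < p := by exact_mod_cast (Fact.out : p.Prime).pos
  have hn := Padic.norm_eq_zpow_neg_valuation ha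
  set v := a.valuation
  obtain ⟨k, hk⟩ := Int.even_or_odd' v
  have hun : ‖a * (p : ℚ_[p]) ^ (-v)‖ = 1 := by
    rw [norm_mul, hn, Padic.norm_p_zpow, ← zpow_add₀ hp1.ne']; simp
  refine ⟨(p : ℚ_[p]) ^ k, a * (p : ℚ_[p]) ^ (-v), zpow_ne_zero _ hp0, hun, ?_⟩
  rcases hk with hk | hk
  · left
    rw [mul_assoc, ← zpow_natCast, ← _root_.zpow_mul, ← zpow_add₀ hp0]
    rw [show -v + k * ((2 : ℕ) : ℤ) = 0 by push_cast; omega]; simp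
  · right
    rw [mul_comm (p : ℚ_[p]), mul_assoc, mul_assoc, ← zpow_natCast, ← _root_.zpow_mul, ← zpow_one_add₀ hp0, ← zpow_add₀ hp0]
    rw [show -v + (1 + k * ((2 : ℕ) : ℤ)) = 0 by push_cast; omega]; simp

lemma exists_nonsq_sum : ∃ x y c : ℚ_[p], c = x ^ 2 + y ^ 2 ∧ ¬ IsSquare c := by
  by_contra! hcon
  have key : ∀ x y : ℚ_[p], IsSquare (x ^ 2 + y ^ 2) := fun x y => hcon x y _ rfl
  obtain ⟨a, b, c, d, h⟩ := Nat.sum_four_squares p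
  obtain ⟨r, hr⟩ := key a b
  obtain ⟨s, hs⟩ := key c d
  apply not_sq_p (p := p)
  have : (p : ℚ_[p]) = r ^ 2 + s ^ 2 := by
    have h' : ((a ^ 2 + b ^ 2 + c ^ 2 + d ^ 2 : ℕ) : ℚ_[p]) = p := by rw [h]
    push_cast at h'
    linear_combination -h' + hr + hs
  rw [this]; exact key r s

def Iso4 (a b c d : ℚ_[p]) : Prop := ∃ x y z w : ℚ_[p],
  (x ≠ 0 ∨ y ≠ 0 ∨ z ≠ 0 ∨ w ≠ 0) ∧ a * x ^ 2 + b * y ^ 2 + c * z ^ 2 + d * w ^ 2 = 0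

lemma Iso4.s12 {a b c d : ℚ_[p]} (h : Iso4 a b c d) : Iso4 b a c d := by
  obtain ⟨x, y, z, w, h0, h⟩ := h
  exact ⟨y, x, z, w, by tauto, by linear_combination h⟩
lemma Iso4.s23 {a b c d : ℚ_[p]} (h : Iso4 a b c d) : Iso4 a c b d := by
  obtain ⟨x, y, z, w, h0, h⟩ := h
  exact ⟨x, z, y, w, by tauto, by linear_combination h⟩
lemma Iso4.s34 {a b c d : ℚ_[p]} (h : Iso4 a b c d) : Iso4 a b d c := by
  obtain ⟨x, y, z, w, h0, h⟩ := h
  exact ⟨x, y, w, z, by tauto, by linear_combination h⟩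
lemma Iso4.scale {a b c d : ℚ_[p]} (t : ℚ_[p]) (ht : t ≠ 0)
    (h : Iso4 (t * a) (t * b) (t * c) (t * d)) : Iso4 a b c d := by
  obtain ⟨x, y, z, w, h0, h⟩ := h
  refine ⟨x, y, z, w, h0, mul_left_cancel₀ ht ?_⟩
  linear_combination h
lemma Iso4.sq1 {a b c d : ℚ_[p]} (t : ℚ_[p]) (ht : t ≠ 0) (h : Iso4 a b c d) :
    Iso4 (a * t ^ 2) b c d := by
  obtain ⟨x, y, z, w, h0, h⟩ := h
  refine ⟨x / t, y, z, w, ?_, ?_⟩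
  · rcases h0 with h0 | h0
    · left; exact div_ne_zero h0 ht
    · right; exact h0
  · field_simp; linear_combination h
lemma Iso4.sqs {a b c d : ℚ_[p]} (s t u v : ℚ_[p]) (hs : s ≠ 0) (ht : t ≠ 0) (hu : u ≠ 0) (hv : v ≠ 0)
    (h : Iso4 a b c d) :
    Iso4 (a * s ^ 2) (b * t ^ 2) (c * u ^ 2) (d * v ^ 2) :=
  (((((h.sq1 s hs).s12.sq1 t ht).s12.s23.s12.sq1 u hu).s12.s23.s34.s23.s12.sq1 v hv).s12.s23.s34)

end padic
end Bur

namespace Bur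

section padic
variable {p : ℕ} [Fact p.Prime]

lemma near_of_dvd (k : ℤ) (h2 : p = 2 → 8 ∣ k) (hp : p ≠ 2 → (p : ℤ) ∣ k) :
    ‖(k : ℚ_[p])‖ < ‖(4 : ℚ_[p])‖ := by
  by_cases h : p = 2
  · subst h
    have h8 := h2 rfl
    have := (Padic.norm_int_le_pow_iff_dvd (p := 2) k 3).2 (by norm_num; exact h8)
    have h4 : ‖(4 : ℚ_[2])‖ = 1 / 4 := by
      rw [norm_four]
      have := Padic.norm_p (p := 2)
      push_cast at this
      rw [this]; norm_num
    rw [h4]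
    refine this.trans_lt ?_
    norm_num
  · have h1 : ‖(k : ℚ_[p])‖ < 1 := (Padic.norm_intCast_lt_one_iff).2 (hp h)
    have h4 : ‖((4 : ℤ) : ℚ_[p])‖ = 1 := by
      refine le_antisymm (Padic.norm_int_le_one _) (not_lt.1 fun h4 => h ?_)
      rw [Padic.norm_intCast_lt_one_iff] at h4
      have h4' : p ∣ 2 ^ 2 := by exact_mod_cast h4
      have := (Fact.out : p.Prime).dvd_of_dvd_pow h4'
      exact (Nat.prime_dvd_prime_iff_eq Fact.out Nat.prime_two).1 this
    push_cast at h4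
    rw [h4]; exact h1

lemma norm_int_one {k : ℤ} (hk : ¬ (p : ℤ) ∣ k) : ‖(k : ℚ_[p])‖ = 1 := by
  refine le_antisymm (Padic.norm_int_le_one _) (not_lt.1 fun h4 => hk ?_)
  rwa [Padic.norm_intCast_lt_one_iff] at h4

lemma hensInt (k x s : ℤ) (hk : ¬ (p : ℤ) ∣ k) (hx : ¬ (p : ℤ) ∣ x)
    (h2 : p = 2 → 8 ∣ k * x ^ 2 + s) (hp : p ≠ 2 → (p : ℤ) ∣ k * x ^ 2 + s) :
    ∃ r : ℚ_[p], r ≠ 0 ∧ k * r ^ 2 + s = 0 := by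
  apply hens (k : ℚ_[p]) x s
  · rw [norm_mul, norm_pow, norm_int_one hk, norm_int_one hx]; norm_num
  · have := near_of_dvd (p := p) (k * x ^ 2 + s) h2 hp
    push_cast at this
    exact this

lemma unit_nat (u : ℚ_[p]) (hu : ‖u‖ = 1) : ∃ (k : ℕ) (s : ℚ_[p]), s ≠ 0 ∧ u = (k : ℤ) * s ^ 2 ∧
    ¬ (p : ℤ) ∣ k ∧ k < p ^ 3 := by
  have hu0 : u ≠ 0 := by intro h0; rw [h0] at hu; simp at hu
  set v : ℤ_[p] := ⟨u, hu.le⟩ with hv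
  have h1 := PadicInt.appr_spec 3 v
  have h2 := PadicInt.appr_lt v 3
  set k := v.appr 3
  rw [← PadicInt.norm_le_pow_iff_mem_span_pow] at h1
  have h3 : ‖u - k‖ ≤ (p : ℝ) ^ (-(3 : ℕ) : ℤ) := h1
  have h5 : ‖((p ^ 3 : ℤ) : ℚ_[p])‖ < ‖(4 : ℚ_[p])‖ := by
    apply near_of_dvd
    · rintro rfl; norm_num
    · intro _; exact dvd_pow_self _ (by norm_num)
  have h6 : ‖u - k‖ < ‖(4 : ℚ_[p])‖ := by
    refine h3.trans_lt ?_
    push_cast at h5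
    rwa [Padic.norm_p_pow] at h5
  have hk1 : ¬ (p : ℤ) ∣ k := by
    intro hd
    have h7 : ‖((k : ℤ) : ℚ_[p])‖ < 1 := (Padic.norm_intCast_lt_one_iff).2 hd
    have h8 : ‖(u - k) + k‖ < 1 := (Padic.nonarchimedean _ _).trans_lt
      (max_lt (h6.trans_le norm_four_le) (by exact_mod_cast h7))
    rw [sub_add_cancel, hu] at h8
    exact lt_irrefl _ h8
  have hk := norm_int_one hk1
  have hk0 : ((k : ℤ) : ℚ_[p]) ≠ 0 := by intro h0; rw [h0] at hk; simp at hk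
  have : IsSquare (u / (k : ℤ)) := by
    apply sq_of_near
    have : 1 - u / (k : ℤ) = - ((u - k) / (k : ℤ)) := by
      field_simp; push_cast; ring
    rw [this, norm_neg, norm_div, hk, div_one]; exact h6
  obtain ⟨s, hs⟩ := this
  rw [div_eq_iff hk0] at hs
  refine ⟨k, s, ?_, by rw [hs]; ring, hk1, h2⟩
  rintro rfl
  simp at hs; exact hu0 hs

lemma isSquare_int (a b : ℤ) (ha : ¬ (p : ℤ) ∣ a)
    (h2 : p = 2 → 8 ∣ a * b - 1) (hp : p ≠ 2 → ∃ r, (p : ℤ) ∣ a * b - r ^ 2) (hb : ¬ (p : ℤ) ∣ b) :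
    IsSquare ((a * b : ℤ) : ℚ_[p]) := by
  by_cases h : p = 2
  · apply sq_of_near
    have := near_of_dvd (p := p) (a * b - 1) h2 (fun h' => absurd h h')
    rw [norm_sub_rev]; exact_mod_cast this
  · obtain ⟨r, hr⟩ := hp h
    have hab : ¬ (p : ℤ) ∣ a * b := by
      intro hh
      rcases (Nat.prime_iff_prime_int.1 Fact.out).dvd_or_dvd hh with h | h
      · exact ha h
      · exact hb h
    have hpr : ¬ (p : ℤ) ∣ r := by
      intro hh
      apply hab
      have h2 := dvd_add hr (dvd_pow hh (two_ne_zero))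
      simpa using h2
    obtain ⟨t, ht0, ht⟩ := hensInt (p := p) (-1) r (a * b) (by
      intro hh
      have := Int.isUnit_iff.2 (Or.inr rfl : (-1 : ℤ) = 1 ∨ (-1 : ℤ) = -1)
      exact (Nat.prime_iff_prime_int.1 (Fact.out : p.Prime)).not_isUnit (isUnit_of_dvd_unit hh this)) hpr
      (fun h' => absurd h' h) (fun _ => by convert hr using 1; ring)
    refine ⟨t, ?_⟩
    push_cast at ht ⊢
    linear_combination ht

lemma dec3 : ∀ u1 ∈ [1, 3, 5, 7], ∀ u2 ∈ [1, 3, 5, 7], ∀ u3 ∈ [1, 3, 5, 7],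
    ∀ e ∈ [1, 3, 5, 7, 2, 6, 10, 14], (e % 2 = 1 → (u1 * u2 * u3 * e) % 8 ≠ 1) →
    ∃ x1 ∈ [0, 1, 2], ∃ x2 ∈ [0, 1, 2], ∃ x3 ∈ [0, 1, 2], ∃ x4 ∈ [0, 1, 2],
     (u1 * x1 ^ 2 + u2 * x2 ^ 2 + u3 * x3 ^ 2 + e * x4 ^ 2) % 8 = 0 ∧ (x1 = 1 ∨ x2 = 1 ∨ x3 = 1) := by
  decide +kernel

lemma dec22 : ∀ u1 ∈ [1, 3, 5, 7], ∀ u2 ∈ [1, 3, 5, 7], ∀ v1 ∈ [1, 3, 5, 7],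
    ∀ v2 ∈ [1, 3, 5, 7], (u1 * u2 * v1 * v2) % 8 ≠ 1 →
    (∃ x3 ∈ [0, 1, 2], ∃ x4 ∈ [0, 1, 2],
     (u1 + u2 + 2 * v1 * x3 ^ 2 + 2 * v2 * x4 ^ 2) % 8 = 0) ∨
    (∃ x3 ∈ [0, 1, 2], ∃ x4 ∈ [0, 1, 2],
     (v1 + v2 + 2 * u1 * x3 ^ 2 + 2 * u2 * x4 ^ 2) % 8 = 0) := by
  decide +kernel

end padic
end Bur

namespace Bur

section padic
variable {p : ℕ} [Fact p.Prime]

lemma mem_odd8 {k : ℕ} (h : ¬ (2 : ℤ) ∣ k) (h8 : k < 8) : k ∈ [1, 3, 5, 7] := by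
  interval_cases k <;> simp_all <;> omega

lemma p_not_dvd_one : ¬ (p : ℤ) ∣ 1 := fun h =>
  (Nat.prime_iff_prime_int.1 (Fact.out : p.Prime)).not_isUnit (isUnit_of_dvd_one h)

lemma iso4_A (u1 u2 u3 k e : ℕ) (h1 : ¬ (p : ℤ) ∣ u1) (h2 : ¬ (p : ℤ) ∣ u2) (h3 : ¬ (p : ℤ) ∣ u3)
    (h1' : u1 < p ^ 3) (h2' : u2 < p ^ 3) (h3' : u3 < p ^ 3)
    (hk : ¬ (p : ℤ) ∣ k) (hk' : k < p ^ 3) (he : e = k ∨ e = p * k)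
    (hns : ¬ IsSquare ((u1 * u2 * u3 * e : ℕ) : ℚ_[p])) :
    Iso4 (u1 : ℚ_[p]) u2 u3 e := by
  by_cases hp2 : p = 2
  · subst hp2
    have m1 := mem_odd8 h1 h1'
    have m2 := mem_odd8 h2 h2'
    have m3 := mem_odd8 h3 h3'
    have mk := mem_odd8 hk hk'
    have me : e ∈ [1, 3, 5, 7, 2, 6, 10, 14] := by
      simp only [List.mem_cons, List.not_mem_nil, or_false] at mk ⊢
      omega
    have hn : e % 2 = 1 → (u1 * u2 * u3 * e) % 8 ≠ 1 := by
      intro _ hh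
      apply hns
      apply sq_of_near
      have := near_of_dvd (p := 2) ((u1 * u2 * u3 * e : ℕ) - 1) (fun _ => by omega) (fun h => absurd rfl h)
      rw [norm_sub_rev]; exact_mod_cast this
    obtain ⟨x1, -, x2, -, x3, -, x4, -, hs, hx⟩ := dec3 u1 m1 u2 m2 u3 m3 e me hn
    have hs' : (8 : ℤ) ∣ (u1 * x1 ^ 2 + u2 * x2 ^ 2 + u3 * x3 ^ 2 + e * x4 ^ 2) := by
      exact_mod_cast Nat.dvd_of_mod_eq_zero hs
    rcases hx with rfl | rfl | rfl
    · obtain ⟨r, hr0, hr⟩ := hensInt (p := 2) u1 1 (u2 * x2 ^ 2 + u3 * x3 ^ 2 + e * x4 ^ 2) h1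
        p_not_dvd_one (fun _ => by convert hs' using 1; push_cast; ring) (fun h => absurd rfl h)
      refine ⟨r, x2, x3, x4, Or.inl hr0, ?_⟩
      push_cast at hr
      linear_combination hr
    · obtain ⟨r, hr0, hr⟩ := hensInt (p := 2) u2 1 (u1 * x1 ^ 2 + u3 * x3 ^ 2 + e * x4 ^ 2) h2
        p_not_dvd_one (fun _ => by convert hs' using 1; push_cast; ring) (fun h => absurd rfl h)
      refine ⟨x1, r, x3, x4, Or.inr (Or.inl hr0), ?_⟩
      push_cast at hr
      linear_combination hr
    · obtain ⟨r, hr0, hr⟩ := hensInt (p := 2) u3 1 (u1 * x1 ^ 2 + u2 * x2 ^ 2 + e * x4 ^ 2) h3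
        p_not_dvd_one (fun _ => by convert hs' using 1; push_cast; ring) (fun h => absurd rfl h)
      refine ⟨x1, x2, r, x4, Or.inr (Or.inr (Or.inl hr0)), ?_⟩
      push_cast at hr
      linear_combination hr
  · have z1 : (u1 : ZMod p) ≠ 0 := by
      intro h; exact h1 (by exact_mod_cast (ZMod.natCast_eq_zero_iff _ _).1 h)
    have z2 : (u2 : ZMod p) ≠ 0 := by
      intro h; exact h2 (by exact_mod_cast (ZMod.natCast_eq_zero_iff _ _).1 h)
    have hodd : Fintype.card (ZMod p) % 2 = 1 := by
      rw [ZMod.card]; exact ((Fact.out : p.Prime).eq_two_or_odd).resolve_left hp2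
    obtain ⟨x, y, hxy⟩ := FiniteField.exists_root_sum_quadratic (R := ZMod p)
      (f := Polynomial.C (u1 : ZMod p) * Polynomial.X ^ 2)
      (g := Polynomial.C (u2 : ZMod p) * Polynomial.X ^ 2 + Polynomial.C (u3 : ZMod p))
      (Polynomial.degree_C_mul_X_pow 2 z1) (by
        rw [Polynomial.degree_add_C, Polynomial.degree_C_mul_X_pow 2 z2]; rfl
        rw [Polynomial.degree_C_mul_X_pow 2 z2]; norm_num) hodd
    simp at hxy
    have hd : (p : ℤ) ∣ u3 * 1 ^ 2 + (u1 * (x.val : ℤ) ^ 2 + u2 * (y.val : ℤ) ^ 2) := by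
      rw [← ZMod.intCast_zmod_eq_zero_iff_dvd]
      push_cast
      simp
      linear_combination hxy
    obtain ⟨r, hr0, hr⟩ := hensInt (p := p) u3 1 _ h3 p_not_dvd_one (fun h => absurd h hp2) (fun _ => hd)
    refine ⟨x.val, y.val, r, 0, Or.inr (Or.inr (Or.inl hr0)), ?_⟩
    push_cast at hr
    linear_combination hr

lemma iso_of_sq (a b c d : ℚ_[p]) (ha : a ≠ 0) (h : IsSquare (-a * b)) : Iso4 a b c d := by
  obtain ⟨t, ht⟩ := h
  refine ⟨t, a, 0, 0, Or.inr (Or.inl ha), ?_⟩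
  linear_combination -a * ht

lemma iso4_B (u1 u2 v1 v2 : ℕ) (h1 : ¬ (p : ℤ) ∣ u1) (h2 : ¬ (p : ℤ) ∣ u2) (h3 : ¬ (p : ℤ) ∣ v1)
    (h4 : ¬ (p : ℤ) ∣ v2)
    (h1' : u1 < p ^ 3) (h2' : u2 < p ^ 3) (h3' : v1 < p ^ 3) (h4' : v2 < p ^ 3)
    (hns : ¬ IsSquare ((u1 * u2 * v1 * v2 : ℕ) : ℚ_[p])) :
    Iso4 (u1 : ℚ_[p]) u2 (p * v1) (p * v2) := by
  have hp0 := p_ne (p := p)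
  by_cases hp2 : p = 2
  · subst hp2
    have m1 := mem_odd8 h1 h1'
    have m2 := mem_odd8 h2 h2'
    have m3 := mem_odd8 h3 h3'
    have m4 := mem_odd8 h4 h4'
    have hn : (u1 * u2 * v1 * v2) % 8 ≠ 1 := by
      intro hh
      apply hns
      apply sq_of_near
      have := near_of_dvd (p := 2) ((u1 * u2 * v1 * v2 : ℕ) - 1) (fun _ => by omega) (fun h => absurd rfl h)
      rw [norm_sub_rev]; exact_mod_cast this
    rcases dec22 u1 m1 u2 m2 v1 m3 v2 m4 hn with ⟨x3, -, x4, -, hs⟩ | ⟨x3, -, x4, -, hs⟩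
    · have hs' : (8 : ℤ) ∣ (u1 + u2 + 2 * v1 * x3 ^ 2 + 2 * v2 * x4 ^ 2) := by
        exact_mod_cast Nat.dvd_of_mod_eq_zero hs
      obtain ⟨r, hr0, hr⟩ := hensInt (p := 2) u1 1 (u2 + 2 * v1 * x3 ^ 2 + 2 * v2 * x4 ^ 2) h1
        p_not_dvd_one (fun _ => by convert hs' using 1; push_cast; ring) (fun h => absurd rfl h)
      refine ⟨r, 1, x3, x4, Or.inl hr0, ?_⟩
      push_cast at hr ⊢
      linear_combination hr
    · have hs' : (8 : ℤ) ∣ (v1 + v2 + 2 * u1 * x3 ^ 2 + 2 * u2 * x4 ^ 2) := by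
        exact_mod_cast Nat.dvd_of_mod_eq_zero hs
      obtain ⟨r, hr0, hr⟩ := hensInt (p := 2) v1 1 (v2 + 2 * u1 * x3 ^ 2 + 2 * u2 * x4 ^ 2) h3
        p_not_dvd_one (fun _ => by convert hs' using 1; push_cast; ring) (fun h => absurd rfl h)
      refine ⟨2 * x3, 2 * x4, r, 1, by tauto, ?_⟩
      push_cast at hr ⊢
      linear_combination 2 * hr
  · have n1 : ∀ k : ℕ, ¬ (p : ℤ) ∣ k → (k : ℚ_[p]) ≠ 0 := by
      rintro k hk h
      apply hk
      have : k = 0 := by exact_mod_cast h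
      subst this; simp
    have z1 : ∀ k : ℕ, ¬ (p : ℤ) ∣ k → (k : ZMod p) ≠ 0 := by
      intro k hk h; exact hk (by exact_mod_cast (ZMod.natCast_eq_zero_iff _ _).1 h)
    have key : ∀ a b : ℤ, ¬ (p : ℤ) ∣ a → ¬ (p : ℤ) ∣ b → IsSquare ((a * b : ℤ) : ZMod p) →
        IsSquare ((a * b : ℤ) : ℚ_[p]) := by
      rintro a b ha hb ⟨r, hr⟩
      refine isSquare_int a b ha (fun h => absurd h hp2) (fun _ => ⟨r.val, ?_⟩) hb
      rw [← ZMod.intCast_zmod_eq_zero_iff_dvd]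
      push_cast at hr ⊢
      simp
      linear_combination hr
    by_cases q1 : IsSquare (((-u1 : ℤ) * u2 : ℤ) : ZMod p)
    · have := key (-u1) u2 (by rwa [Int.dvd_neg]) h2 q1
      apply iso_of_sq _ _ _ _ (n1 _ h1)
      exact_mod_cast this
    by_cases q2 : IsSquare (((-v1 : ℤ) * v2 : ℤ) : ZMod p)
    · have := key (-v1) v2 (by rwa [Int.dvd_neg]) h4 q2
      apply Iso4.s12
      apply Iso4.s23
      apply Iso4.s12
      apply Iso4.s34
      apply Iso4.s23
      apply Iso4.s34
      apply Iso4.s34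
      apply iso_of_sq _ _ _ _ (mul_ne_zero hp0 (n1 _ h3))
      obtain ⟨t, ht⟩ := this
      refine ⟨p * t, ?_⟩
      push_cast at ht
      linear_combination p ^ 2 * ht
    exfalso
    apply hns
    have hsq : IsSquare (((u1 * u2 : ℤ) * (v1 * v2 : ℤ) : ℤ) : ZMod p) := by
      have hc : ringChar (ZMod p) ≠ 2 := by rwa [ZMod.ringChar_zmod_n]
      rw [← quadraticChar_neg_one_iff_not_isSquare] at q1 q2
      have h0 : (((u1 * u2 : ℤ) * (v1 * v2 : ℤ) : ℤ) : ZMod p) ≠ 0 := by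
        push_cast
        exact mul_ne_zero (mul_ne_zero (z1 _ h1) (z1 _ h2)) (mul_ne_zero (z1 _ h3) (z1 _ h4))
      rw [← quadraticChar_one_iff_isSquare h0]
      have : (((u1 * u2 : ℤ) * (v1 * v2 : ℤ) : ℤ) : ZMod p) =
        (((-u1 : ℤ) * u2 : ℤ) : ZMod p) * (((-v1 : ℤ) * v2 : ℤ) : ZMod p) := by push_cast; ring
      rw [this, map_mul, q1, q2]; norm_num
    have hP := (Nat.prime_iff_prime_int.1 (Fact.out : p.Prime))
    have := key _ _ (fun h => (hP.dvd_or_dvd h).elim h1 h2) (fun h => (hP.dvd_or_dvd h).elim h3 h4) hsq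
    convert this using 1
    push_cast; ring

end padic
end Bur

namespace Bur

section padic
variable {p : ℕ} [Fact p.Prime]

def NU (p k : ℕ) : Prop := ¬ (p : ℤ) ∣ k ∧ k < p ^ 3

lemma nat_form (a : ℚ_[p]) (ha : a ≠ 0) : ∃ (k : ℕ) (s : ℚ_[p]), s ≠ 0 ∧ NU p k ∧
    (a = k * s ^ 2 ∨ a = (p * k) * s ^ 2) := by
  obtain ⟨s, u, hs, hu, h⟩ := normal_form a ha
  obtain ⟨k, t, ht, hk, h1, h2⟩ := unit_nat u hu
  refine ⟨k, t * s, mul_ne_zero ht hs, ⟨h1, h2⟩, ?_⟩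
  rcases h with h | h
  · left; rw [h, hk]; push_cast; ring
  · right; rw [h, hk]; push_cast; ring

lemma iso4_A' {u1 u2 u3 k : ℕ} {e : ℚ_[p]} (h1 : NU p u1) (h2 : NU p u2) (h3 : NU p u3) (hk : NU p k)
    (he : e = k ∨ e = p * k) (hns : ¬ IsSquare (u1 * u2 * u3 * e)) :
    Iso4 (u1 : ℚ_[p]) u2 u3 e := by
  rcases he with rfl | rfl
  · exact iso4_A u1 u2 u3 k k h1.1 h2.1 h3.1 h1.2 h2.2 h3.2 hk.1 hk.2 (Or.inl rfl) (by exact_mod_cast hns)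
  · have := iso4_A u1 u2 u3 k (p * k) h1.1 h2.1 h3.1 h1.2 h2.2 h3.2 hk.1 hk.2 (Or.inr rfl)
      (by exact_mod_cast hns)
    exact_mod_cast this

lemma nsq {a b s : ℚ_[p]} (h : ¬ IsSquare a) (hab : a = b * s ^ 2) : ¬ IsSquare b := by
  rintro ⟨t, rfl⟩
  exact h ⟨t * s, by rw [hab]; ring⟩

lemma iso4_A'' {u1 u2 u3 k : ℕ} {e : ℚ_[p]} (h1 : NU p u1) (h2 : NU p u2) (h3 : NU p u3) (hk : NU p k)
    (he : e = k ∨ e = p * k) (hns : ¬ IsSquare ((p * u1) * (p * u2) * (p * u3) * e)) :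
    Iso4 (p * u1 : ℚ_[p]) (p * u2) (p * u3) e := by
  have hp0 := p_ne (p := p)
  apply Iso4.scale _ hp0
  rcases he with rfl | rfl
  · have := (iso4_A' h1 h2 h3 hk (Or.inr rfl)
      (nsq (s := p) hns (by ring))).sqs p p p 1 hp0 hp0 hp0 one_ne_zero
    convert this using 1 <;> ring
  · have := (iso4_A' h1 h2 h3 hk (Or.inl rfl)
      (nsq (s := p ^ 2) hns (by ring))).sqs p p p p hp0 hp0 hp0 hp0
    convert this using 1 <;> ring

lemma iso4_B' {u1 u2 v1 v2 : ℕ} (h1 : NU p u1) (h2 : NU p u2) (h3 : NU p v1) (h4 : NU p v2)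
    (hns : ¬ IsSquare ((u1 : ℚ_[p]) * u2 * (p * v1) * (p * v2))) :
    Iso4 (u1 : ℚ_[p]) u2 (p * v1) (p * v2) := by
  apply iso4_B u1 u2 v1 v2 h1.1 h2.1 h3.1 h4.1 h1.2 h2.2 h3.2 h4.2
  apply nsq (s := p) hns
  push_cast; ring

theorem iso4 {a b c d : ℚ_[p]} (ha : a ≠ 0) (hb : b ≠ 0) (hc : c ≠ 0) (hd : d ≠ 0)
    (hns : ¬ IsSquare (a * b * c * d)) : Iso4 a b c d := by
  obtain ⟨k1, s1, hs1, n1, h1⟩ := nat_form a ha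
  obtain ⟨k2, s2, hs2, n2, h2⟩ := nat_form b hb
  obtain ⟨k3, s3, hs3, n3, h3⟩ := nat_form c hc
  obtain ⟨k4, s4, hs4, n4, h4⟩ := nat_form d hd
  rcases h1 with rfl | rfl <;> rcases h2 with rfl | rfl <;> rcases h3 with rfl | rfl <;>
    rcases h4 with rfl | rfl <;> apply Iso4.sqs _ _ _ _ hs1 hs2 hs3 hs4
  -- 0000
  · exact iso4_A' n1 n2 n3 n4 (Or.inl rfl) (nsq (s := s1 * s2 * s3 * s4) hns (by ring))
  -- 0001
  · exact iso4_A' n1 n2 n3 n4 (Or.inr rfl) (nsq (s := s1 * s2 * s3 * s4) hns (by ring))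
  -- 0010
  · exact (iso4_A' n1 n2 n4 n3 (Or.inr rfl) (nsq (s := s1 * s2 * s3 * s4) hns (by ring))).s34
  -- 0011
  · exact iso4_B' n1 n2 n3 n4 (nsq (s := s1 * s2 * s3 * s4) hns (by ring))
  -- 0100
  · exact (iso4_A' n1 n3 n4 n2 (Or.inr rfl) (nsq (s := s1 * s2 * s3 * s4) hns (by ring))).s34.s23
  -- 0101
  · exact (iso4_B' n1 n3 n2 n4 (nsq (s := s1 * s2 * s3 * s4) hns (by ring))).s23
  -- 0110
  · exact (iso4_B' n1 n4 n2 n3 (nsq (s := s1 * s2 * s3 * s4) hns (by ring))).s23.s34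
  -- 0111
  · exact (iso4_A'' n2 n3 n4 n1 (Or.inl rfl) (nsq (s := s1 * s2 * s3 * s4) hns (by ring))).s34.s23.s12
  -- 1000
  · exact (iso4_A' n2 n3 n4 n1 (Or.inr rfl) (nsq (s := s1 * s2 * s3 * s4) hns (by ring))).s34.s23.s12
  -- 1001
  · exact (iso4_B' n2 n3 n1 n4 (nsq (s := s1 * s2 * s3 * s4) hns (by ring))).s23.s12
  -- 1010
  · exact (iso4_B' n2 n4 n1 n3 (nsq (s := s1 * s2 * s3 * s4) hns (by ring))).s23.s12.s34
  -- 1011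
  · exact (iso4_A'' n1 n3 n4 n2 (Or.inl rfl) (nsq (s := s1 * s2 * s3 * s4) hns (by ring))).s34.s23
  -- 1100
  · exact (iso4_B' n3 n4 n1 n2 (nsq (s := s1 * s2 * s3 * s4) hns (by ring))).s23.s12.s34.s23
  -- 1101
  · exact (iso4_A'' n1 n2 n4 n3 (Or.inl rfl) (nsq (s := s1 * s2 * s3 * s4) hns (by ring))).s34
  -- 1110
  · exact (iso4_A'' n1 n2 n3 n4 (Or.inl rfl) (nsq (s := s1 * s2 * s3 * s4) hns (by ring)))
  -- 1111
  · exact (iso4_A'' n1 n2 n3 n4 (Or.inr rfl) (nsq (s := s1 * s2 * s3 * s4) hns (by ring)))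

lemma univ2 {a b x y : ℚ_[p]} (ha : a ≠ 0) (hb : b ≠ 0) (h0 : x ≠ 0 ∨ y ≠ 0)
    (h : a * x ^ 2 + b * y ^ 2 = 0) (t : ℚ_[p]) : ∃ X Y, a * X ^ 2 + b * Y ^ 2 = t := by
  have hy : y ≠ 0 := by
    rintro rfl
    simp [ha] at h
    simp [h] at h0
  have hx : x ≠ 0 := by
    rintro rfl
    simp [hb] at h
    simp [h] at h0
  refine ⟨(t / a + 1) / 2, (t / a - 1) / 2 * (y / x), ?_⟩
  field_simp
  linear_combination (t - a) ^ 2 * h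

/-- two binary forms with nonsquare discriminant product share a nonzero value -/
theorem common_value {a b c d : ℚ_[p]} (ha : a ≠ 0) (hb : b ≠ 0) (hc : c ≠ 0) (hd : d ≠ 0)
    (hns : ¬ IsSquare (a * b * c * d)) :
    ∃ v x y z w : ℚ_[p], v ≠ 0 ∧ v = a * x ^ 2 + b * y ^ 2 ∧ v = c * z ^ 2 + d * w ^ 2 := by
  obtain ⟨x, y, z, w, h0, h⟩ := iso4 ha hb (neg_ne_zero.2 hc) (neg_ne_zero.2 hd)
    (by convert hns using 2; ring)
  by_cases hv : a * x ^ 2 + b * y ^ 2 = 0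
  · by_cases hxy : x ≠ 0 ∨ y ≠ 0
    · obtain ⟨X, Y, hXY⟩ := univ2 ha hb hxy hv c
      exact ⟨c, X, Y, 1, 0, hc, hXY.symm, by ring⟩
    · have hzw : z ≠ 0 ∨ w ≠ 0 := by tauto
      obtain ⟨X, Y, hXY⟩ := univ2 hc hd hzw (by linear_combination -h + hv) a
      exact ⟨a, 1, 0, X, Y, ha, by ring, hXY.symm⟩
  · exact ⟨_, x, y, z, w, hv, rfl, by linear_combination h⟩

end padic
end Bur

namespace Bur

section lists
variable {K : Type} [Field K]

def Hs {V : Type} [AddCommGroup V] [Module K V] (B : LinearMap.BilinForm K V) (vs : List V) (l : List K) : Prop :=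
  List.Forall₂ (fun v a => B v v = a) vs l ∧ vs.Pairwise (fun v w => B v w = 0)

def Rel (l l' : List K) : Prop :=
  ∀ (V : Type) [AddCommGroup V] [Module K V] (B : LinearMap.BilinForm K V) (_ : ∀ x y, B x y = B y x)
    (vs : List V), Hs B vs l → ∃ vs' : List V, Hs B vs' l' ∧ ∀ v ∈ vs', v ∈ Submodule.span K {w | w ∈ vs}

lemma Rel.refl (l : List K) : Rel l l := fun V _ _ B _ vs h =>
  ⟨vs, h, fun v hv => Submodule.subset_span hv⟩

lemma Rel.trans {l₁ l₂ l₃ : List K} (h : Rel l₁ l₂) (h' : Rel l₂ l₃) : Rel l₁ l₃ := by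
  intro V _ _ B hB vs hvs
  obtain ⟨vs', h1, h2⟩ := h V B hB vs hvs
  obtain ⟨vs'', h3, h4⟩ := h' V B hB vs' h1
  exact ⟨vs'', h3, fun v hv => Submodule.span_le.2 h2 (h4 v hv)⟩

lemma orth_span {V : Type} [AddCommGroup V] [Module K V] (B : LinearMap.BilinForm K V) (v : V) (vs : List V)
    (h : ∀ w ∈ vs, B v w = 0) (x : V) (hx : x ∈ Submodule.span K {w | w ∈ vs}) : B v x = 0 := by
  have : Submodule.span K {w | w ∈ vs} ≤ LinearMap.ker (B v) := Submodule.span_le.2 (fun w hw => h w hw)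
  exact this hx

lemma Rel.cons {l l' : List K} (a : K) (h : Rel l l') : Rel (a :: l) (a :: l') := by
  rintro V _ _ B hB vs ⟨h1, h2⟩
  cases h1 with
  | @cons v _ vs _ hv hvs =>
    rw [List.pairwise_cons] at h2
    obtain ⟨vs', ⟨h3, h4⟩, h5⟩ := h V B hB vs ⟨hvs, h2.2⟩
    refine ⟨v :: vs', ⟨List.Forall₂.cons hv h3, List.pairwise_cons.2 ⟨fun w hw => ?_, h4⟩⟩, ?_⟩
    · exact orth_span B v vs h2.1 w (h5 w hw)
    · intro w hw
      rcases List.mem_cons.1 hw with rfl | hw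
      · exact Submodule.subset_span (by simp)
      · exact Submodule.span_mono (fun x hx => List.mem_cons_of_mem _ hx) (h5 w hw)

lemma Rel.tail (a : K) (l : List K) : Rel (a :: l) l := by
  rintro V _ _ B hB vs ⟨h1, h2⟩
  cases h1 with
  | @cons v _ vs _ hv hvs =>
    rw [List.pairwise_cons] at h2
    exact ⟨vs, ⟨hvs, h2.2⟩, fun w hw => Submodule.subset_span (List.mem_cons_of_mem _ hw)⟩

lemma Rel.bin (a b x y z w : K) (l : List K) (h : x * z * a + y * w * b = 0) :
    Rel (a :: b :: l) ((x ^ 2 * a + y ^ 2 * b) :: (z ^ 2 * a + w ^ 2 * b) :: l) := by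
  rintro V _ _ B hB vs ⟨h1, h2⟩
  cases h1 with
  | @cons v _ vs _ hv hvs =>
    cases hvs with
    | @cons v' _ vs _ hv' hvs =>
      rw [List.pairwise_cons, List.pairwise_cons] at h2
      obtain ⟨h3, h4, h5⟩ := h2
      have h0 : B v v' = 0 := h3 v' (by simp)
      have h0' : B v' v = 0 := by rw [hB]; exact h0
      have h3' : ∀ u ∈ vs, B v u = 0 := fun u hu => h3 u (by simp [hu])
      refine ⟨(x • v + y • v') :: (z • v + w • v') :: vs, ⟨?_, ?_⟩, ?_⟩
      · refine List.Forall₂.cons ?_ (List.Forall₂.cons ?_ hvs)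
        · simp only [map_add, map_smul, LinearMap.add_apply, LinearMap.smul_apply, hv, hv', h0, h0', smul_eq_mul]
          ring
        · simp only [map_add, map_smul, LinearMap.add_apply, LinearMap.smul_apply, hv, hv', h0, h0', smul_eq_mul]
          ring
      · refine List.pairwise_cons.2 ⟨?_, List.pairwise_cons.2 ⟨?_, h5⟩⟩
        · intro u hu
          rcases List.mem_cons.1 hu with rfl | hu
          · simp only [map_add, map_smul, LinearMap.add_apply, LinearMap.smul_apply, hv, hv', h0, h0', smul_eq_mul]
            linear_combination h
          · simp [h3' u hu, h4 u hu]
        · intro u hu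
          simp [h3' u hu, h4 u hu]
      · have m1 : v ∈ Submodule.span K {w | w ∈ v :: v' :: vs} := Submodule.subset_span (by simp)
        have m2 : v' ∈ Submodule.span K {w | w ∈ v :: v' :: vs} := Submodule.subset_span (by simp)
        intro u hu
        rcases List.mem_cons.1 hu with rfl | hu
        · exact Submodule.add_mem _ (Submodule.smul_mem _ _ m1) (Submodule.smul_mem _ _ m2)
        rcases List.mem_cons.1 hu with rfl | hu
        · exact Submodule.add_mem _ (Submodule.smul_mem _ _ m1) (Submodule.smul_mem _ _ m2)
        exact Submodule.subset_span (by simp [hu])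

structure E (l l' : List K) : Prop where
  r : Rel l l'
  r' : Rel l' l
  len : l.length = l'.length
  sq : ∃ s : K, s ≠ 0 ∧ l'.prod = l.prod * s ^ 2

lemma E.refl (l : List K) : E l l := ⟨Rel.refl l, Rel.refl l, rfl, 1, one_ne_zero, by simp⟩

lemma E.trans {l₁ l₂ l₃ : List K} (h : E l₁ l₂) (h' : E l₂ l₃) : E l₁ l₃ := by
  obtain ⟨s, hs, h1⟩ := h.sq
  obtain ⟨t, ht, h2⟩ := h'.sq
  exact ⟨h.r.trans h'.r, h'.r'.trans h.r', h.len.trans h'.len, s * t, mul_ne_zero hs ht, by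
    rw [h2, h1]; ring⟩

lemma E.cons {l l' : List K} (a : K) (h : E l l') : E (a :: l) (a :: l') := by
  obtain ⟨s, hs, h1⟩ := h.sq
  exact ⟨h.r.cons a, h.r'.cons a, by simp [h.len], s, hs, by simp [h1]; ring⟩

lemma E.bin (a b x y z w a' b' : K) (l : List K) (h : x * z * a + y * w * b = 0) (hD : x * w - y * z ≠ 0)
    (ha' : a' = x ^ 2 * a + y ^ 2 * b) (hb' : b' = z ^ 2 * a + w ^ 2 * b) :
    E (a :: b :: l) (a' :: b' :: l) := by
  refine ⟨?_, ?_, rfl, x * w - y * z, hD, ?_⟩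
  · rw [ha', hb']; exact Rel.bin a b x y z w l h
  · obtain ⟨i, hi⟩ : ∃ i, i * (x * w - y * z) = 1 := ⟨_, inv_mul_cancel₀ hD⟩
    have := Rel.bin a' b' (w * i) (-y * i) (-z * i) (x * i) l (by
        rw [ha', hb']; linear_combination -i ^ 2 * (w * x + y * z) * h)
    convert this using 2
    · rw [ha', hb']
      linear_combination -a * (i * (x * w - y * z) + 1) * hi - 2 * i ^ 2 * y * w * h
    · congr 1
      rw [ha', hb']
      linear_combination -b * (i * (x * w - y * z) + 1) * hi - 2 * i ^ 2 * x * z * h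
  · simp only [List.prod_cons, ha', hb']
    linear_combination (x * z * a + y * w * b) * l.prod * h

lemma E.swap (a b : K) (l : List K) : E (a :: b :: l) (b :: a :: l) :=
  E.bin a b 0 1 1 0 b a l (by ring) (by simp) (by ring) (by ring)

/-- represented value splits off -/
lemma E.value (a b x y c : K) (l : List K) (hc : c ≠ 0) (h : c = a * x ^ 2 + b * y ^ 2) :
    E (a :: b :: l) (c :: (c * a * b) :: l) :=
  E.bin a b x y (-b * y) (a * x) _ _ l (by ring) (by convert hc using 1; rw [h]; ring)
    (by rw [h]; ring) (by rw [h]; ring)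

end lists

section padic
variable {p : ℕ} [Fact p.Prime]

lemma sq_mul_iff {a s : ℚ_[p]} (hs : s ≠ 0) : IsSquare (a * s ^ 2) ↔ IsSquare a := by
  constructor
  · rintro ⟨t, ht⟩
    exact ⟨t / s, by field_simp; linear_combination ht⟩
  · rintro ⟨t, rfl⟩
    exact ⟨t * s, by ring⟩

lemma arrange (a1 a2 : ℚ_[p]) (a' : List ℚ_[p]) (b1 b2 : ℚ_[p]) (b' : List ℚ_[p])
    (hlen : a'.length = b'.length)
    (h : ¬ IsSquare ((a1 :: a2 :: a').prod * (b1 :: b2 :: b').prod)) :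
    ∃ c1 c2 c', E (a1 :: a2 :: a') (c1 :: c2 :: c') ∧ ¬ IsSquare (c1 * c2 * b1 * b2) := by
  by_cases h1 : IsSquare (a1 * a2 * b1 * b2)
  swap
  · exact ⟨a1, a2, a', E.refl _, h1⟩
  rcases a' with _ | ⟨a3, a'⟩
  · have : b' = [] := List.eq_nil_of_length_eq_zero (by simpa using hlen.symm)
    subst this
    exfalso; apply h; convert h1 using 1; simp; ring
  have hne : (a1 :: a2 :: a3 :: a').prod * (b1 :: b2 :: b').prod ≠ 0 := by
    intro h0; apply h; rw [h0]; exact IsSquare.zero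
  simp only [List.prod_cons, mul_ne_zero_iff] at hne
  obtain ⟨⟨ha1, ha2, ha3, -⟩, hb1, hb2, -⟩ := hne
  by_cases h2 : IsSquare (a1 * a3 * b1 * b2)
  swap
  · exact ⟨a1, a3, a2 :: a', (E.swap _ _ _).cons _, h2⟩
  obtain ⟨s, hs⟩ := h1
  obtain ⟨t, ht⟩ := h2
  have hs0 : s ≠ 0 := by
    rintro rfl
    simp [ha1, ha2, hb1, hb2] at hs
  have ht0 : t ≠ 0 := by
    rintro rfl
    simp [ha1, ha3, hb1, hb2] at ht
  obtain ⟨x, y, c, hc, hcn⟩ := exists_nonsq_sum (p := p)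
  have hc0 : c ≠ 0 := by rintro rfl; exact hcn IsSquare.zero
  set r := t / s with hr
  have hr0 : r ≠ 0 := div_ne_zero ht0 hs0
  have h3 : a3 = a2 * r ^ 2 := by
    have hk : a1 * b1 * b2 ≠ 0 := mul_ne_zero (mul_ne_zero ha1 hb1) hb2
    have h4 : a3 * s ^ 2 = a2 * t ^ 2 := by
      apply mul_left_cancel₀ hk
      linear_combination s ^ 2 * ht - t ^ 2 * hs
    rw [hr]; field_simp
    linear_combination h4
  refine ⟨a1, a2 * c, (a3 * c) :: a', (E.bin a2 a3 x (y / r) (-y * r) x _ _ a' ?_ ?_ ?_ ?_).cons _, ?_⟩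
  · rw [h3]; field_simp; ring
  · convert hc0 using 1; rw [hc]; field_simp; ring
  · rw [h3, hc]; field_simp
  · rw [h3, hc]; ring
  · have : a1 * (a2 * c) * b1 * b2 = c * s ^ 2 := by linear_combination c * hs
    rw [this, sq_mul_iff hs0]; exact hcn

theorem listB : ∀ (n : ℕ) (a b : List ℚ_[p]), a.length = n + 1 → b.length = n + 1 →
    ¬ IsSquare (a.prod * b.prod) → ∃ α β, α ≠ 0 ∧ β ≠ 0 ∧ Rel (α :: a) (β :: b) := by
  intro n
  induction n with
  | zero =>
    intro a b ha hb h
    obtain ⟨x, rfl⟩ := List.length_eq_one_iff.1 ha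
    obtain ⟨y, rfl⟩ := List.length_eq_one_iff.1 hb
    refine ⟨y, x, ?_, ?_, (E.swap y x []).r⟩
    · rintro rfl; simp at h
    · rintro rfl; simp at h
  | succ n ih =>
    intro a b ha hb h
    rcases a with _ | ⟨a1, _ | ⟨a2, a'⟩⟩
    · simp at ha
    · simp at ha
    rcases b with _ | ⟨b1, _ | ⟨b2, b'⟩⟩
    · simp at hb
    · simp at hb
    simp only [List.length_cons] at ha hb
    obtain ⟨c1, c2, c', hE, hns⟩ := arrange a1 a2 a' b1 b2 b' (by omega) h
    have hne : c1 * c2 * b1 * b2 ≠ 0 := by intro h0; apply hns; rw [h0]; exact IsSquare.zero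
    simp only [mul_ne_zero_iff] at hne
    obtain ⟨⟨⟨hc1, hc2⟩, hb1⟩, hb2⟩ := hne
    obtain ⟨v, x, y, z, w, hv, hv1, hv2⟩ := common_value hc1 hc2 hb1 hb2 hns
    have E1 := hE.trans (E.value c1 c2 x y v c' hv hv1)
    have E2 := E.value b1 b2 z w v b' hv hv2
    have hl := hE.len
    simp only [List.length_cons] at hl
    obtain ⟨s, hs, hs'⟩ := hE.sq
    obtain ⟨α, β, hα, hβ, hR⟩ := ih ((v * c1 * c2) :: c') ((v * b1 * b2) :: b')
      (by simp; omega) (by simp; omega) (by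
        rw [← sq_mul_iff hs] at h
        rw [← sq_mul_iff hv] at h
        convert h using 2
        simp only [List.prod_cons] at hs' ⊢
        linear_combination v ^ 2 * b1 * b2 * b'.prod * hs')
    refine ⟨α, β, hα, hβ, ?_⟩
    refine (E1.r.cons α).trans ?_
    refine (E.swap _ _ _).r.trans ?_
    refine (hR.cons v).trans ?_
    refine (E.swap _ _ _).r.trans ?_
    exact E2.r'.cons β

theorem list1 (a b : List ℚ_[p]) (m : ℕ) (ha : a.length = m + 1) (hb : b.length = m + 1)
    (h : ¬ IsSquare (a.prod * b.prod)) : ∃ l : List ℚ_[p], l.length = m + 2 ∧ l.prod ≠ 0 ∧ Rel l a ∧ Rel l b := by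
  obtain ⟨α, β, hα, hβ, hR⟩ := listB m a b ha hb h
  refine ⟨α :: a, by simp [ha], ?_, Rel.tail _ _, hR.trans (Rel.tail _ _)⟩
  rw [List.prod_cons]
  refine mul_ne_zero hα ?_
  intro h0; apply h; rw [h0]; simp

theorem list2 (a b : List ℚ_[p]) (m : ℕ) (ha : a.length = m) (hb : b.length = m)
    (ha0 : a.prod ≠ 0) (hb0 : b.prod ≠ 0) :
    ∃ l : List ℚ_[p], l.length = m + 2 ∧ l.prod ≠ 0 ∧ Rel l a ∧ Rel l b := by
  obtain ⟨l, h1, h2, h3, h4⟩ := list1 (1 :: a) ((p * a.prod * b.prod) :: b) m (by simp [ha]) (by simp [hb]) (by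
    have := not_sq_p (p := p)
    rw [← sq_mul_iff (mul_ne_zero ha0 hb0)] at this
    convert this using 2
    simp; ring)
  exact ⟨l, h1, h2, h3.trans (Rel.tail _ _), h4.trans (Rel.tail _ _)⟩

theorem list_pad (a b : List ℚ_[p]) (m k : ℕ)
    (h : ∃ l : List ℚ_[p], l.length = m ∧ l.prod ≠ 0 ∧ Rel l a ∧ Rel l b) :
    ∃ l : List ℚ_[p], l.length = m + k ∧ l.prod ≠ 0 ∧ Rel l a ∧ Rel l b := by
  induction k with
  | zero => exact h
  | succ k ih =>
    obtain ⟨l, h1, h2, h3, h4⟩ := ih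
    exact ⟨1 :: l, by simp [h1]; rfl, by simpa using h2, (Rel.tail _ _).trans h3, (Rel.tail _ _).trans h4⟩

end padic
end Bur

namespace Bur

section witt
variable {K : Type} [Field K] [CharZero K] {V : Type} [AddCommGroup V] [Module K V]

def Pres (B : LinearMap.BilinForm K V) (σ : V →ₗ[K] V) : Prop := ∀ u v, B (σ u) (σ v) = B u v

lemma Pres.comp {B : LinearMap.BilinForm K V} {σ τ : V →ₗ[K] V} (h : Pres B σ) (h' : Pres B τ) :
    Pres B (σ ∘ₗ τ) := fun u v => by simp [h _ _, h' _ _]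

noncomputable def rfl_ (B : LinearMap.BilinForm K V) (u : V) : V →ₗ[K] V :=
  LinearMap.id - ((2 / B u u) • (B u)).smulRight u

lemma rfl_apply (B : LinearMap.BilinForm K V) (u v : V) : rfl_ B u v = v - (2 / B u u * B u v) • u := by
  simp [rfl_]

lemma rfl_pres (B : LinearMap.BilinForm K V) (hB : ∀ x y, B x y = B y x) (u : V) (hu : B u u ≠ 0) :
    Pres B (rfl_ B u) := by
  intro v w
  simp only [rfl_apply, map_sub, map_smul, LinearMap.sub_apply, LinearMap.smul_apply, smul_eq_mul]
  rw [hB v u]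
  field_simp
  ring

lemma witt1 (B : LinearMap.BilinForm K V) (hB : ∀ x y, B x y = B y x) (x y : V) (h : B x x = B y y)
    (h0 : B y y ≠ 0) : ∃ σ : V →ₗ[K] V, Pres B σ ∧ σ x = y ∧ ∀ z, B z x = 0 → B z y = 0 → σ z = z := by
  by_cases hD : B (x - y) (x - y) = 0
  · have hxy : B x y = B y y := by
      simp only [map_sub, LinearMap.sub_apply, hB y x, h] at hD
      have h2 : (2 : K) ≠ 0 := two_ne_zero
      apply mul_left_cancel₀ h2
      linear_combination -hD
    have hS : B (x + y) (x + y) = 4 * B y y := by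
      simp only [map_add, LinearMap.add_apply, hB y x, h, hxy]; ring
    have hS0 : B (x + y) (x + y) ≠ 0 := by rw [hS]; exact mul_ne_zero (by norm_num) h0
    refine ⟨rfl_ B y ∘ₗ rfl_ B (x + y), (rfl_pres B hB y h0).comp (rfl_pres B hB _ hS0), ?_, ?_⟩
    · have h1 : rfl_ B (x + y) x = -y := by
        rw [rfl_apply, hS]
        have : 2 / (4 * B y y) * B (x + y) x = 1 := by
          simp only [map_add, LinearMap.add_apply, hB y x, h, hxy]; field_simp; norm_num
        rw [this]; simp
      rw [LinearMap.comp_apply, h1, rfl_apply]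
      have : 2 / B y y * B y (-y) = -2 := by
        simp only [map_neg]; field_simp
      rw [this]; module
    · intro z hx hy
      have h1 : rfl_ B (x + y) z = z := by
        rw [rfl_apply, hB _ z]; simp [hx, hy]
      rw [LinearMap.comp_apply, h1, rfl_apply, hB _ z, hy]; simp
  · refine ⟨rfl_ B (x - y), rfl_pres B hB _ hD, ?_, ?_⟩
    · rw [rfl_apply]
      have : 2 / B (x - y) (x - y) * B (x - y) x = 1 := by
        rw [div_mul_eq_mul_div, div_eq_one_iff_eq hD]
        simp only [map_sub, LinearMap.sub_apply, hB y x, h]; ring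
      rw [this]; simp
    · intro z hx hy
      rw [rfl_apply, hB _ z]; simp [hx, hy]

lemma witt2 (B : LinearMap.BilinForm K V) (hB : ∀ x y, B x y = B y x) (e f e' f' : V)
    (hee : B e e = 0) (hff : B f f = 0) (hef : B e f = 1)
    (hee' : B e' e' = 0) (hff' : B f' f' = 0) (hef' : B e' f' = 1) :
    ∃ σ : V →ₗ[K] V, Pres B σ ∧ σ e = e' ∧ σ f = f' := by
  have hfe : B f e = 1 := by rw [hB]; exact hef
  have hfe' : B f' e' = 1 := by rw [hB]; exact hef'
  obtain ⟨σ, h1, h2, -⟩ := witt1 B hB (e + f) (e' + f')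
    (by simp [*]) (by simp [*])
  obtain ⟨τ, h3, h4, h5⟩ := witt1 B hB (σ (e - f)) (e' - f')
    (by rw [h1]; simp [*]) (by simp [*]; norm_num)
  have h6 : τ (e' + f') = e' + f' := by
    apply h5
    · rw [← h2, h1]; simp [*]
    · simp [*]
  have h7 : τ (σ (e + f)) = e' + f' := by rw [h2, h6]
  rw [map_add, map_add] at h7
  rw [map_sub, map_sub] at h4
  refine ⟨τ ∘ₗ σ, h3.comp h1, ?_, ?_⟩
  · have h2 : (2 : K) ≠ 0 := two_ne_zero
    apply smul_right_injective V h2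
    show (2 : K) • τ (σ e) = (2 : K) • e'
    rw [two_smul, two_smul]
    have : (τ (σ e) + τ (σ f)) + (τ (σ e) - τ (σ f)) = (e' + f') + (e' - f') := by rw [h7, h4]
    simpa using this
  · have h2 : (2 : K) ≠ 0 := two_ne_zero
    apply smul_right_injective V h2
    show (2 : K) • τ (σ f) = (2 : K) • f'
    rw [two_smul, two_smul]
    have : (τ (σ e) + τ (σ f)) - (τ (σ e) - τ (σ f)) = (e' + f') - (e' - f') := by rw [h7, h4]
    simpa using this

end witt

section lat
variable {p : ℕ} [Fact p.Prime] {V : Type} [AddCommGroup V] [Module ℚ_[p] V]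

structure Ev (B : LinearMap.BilinForm ℚ_[p] V) (s : Set V) : Prop where
  fin : s.Finite
  d : ∀ v ∈ s, ‖B v v‖ ≤ ‖(2 : ℚ_[p])‖
  o : ∀ v ∈ s, ∀ w ∈ s, ‖B v w‖ ≤ 1

lemma aniso (B : LinearMap.BilinForm ℚ_[p] V) (hB : ∀ x y, B x y = B y x)
    (hA : ∀ x, B x x = 0 → x = 0) (x y : V) (hx : ‖B x x‖ ≤ ‖(2 : ℚ_[p])‖) (hy : ‖B y y‖ ≤ ‖(2 : ℚ_[p])‖) :
    ‖B x y‖ ≤ 1 := by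
  by_contra! hb
  set a := B x x with ha
  set c := B y y with hc
  set b := B x y with hbdef
  have hb0 : b ≠ 0 := by intro h; rw [h] at hb; simp at hb; linarith
  have hsq : IsSquare (1 - a * c / b ^ 2) := by
    apply sq_of_near
    rw [sub_sub_cancel, norm_div, norm_mul, norm_pow, norm_four, div_lt_iff₀ (by positivity)]
    have h2 := norm_two_pos (p := p)
    calc ‖a‖ * ‖c‖ ≤ ‖(2 : ℚ_[p])‖ * ‖(2 : ℚ_[p])‖ := by gcongr
      _ < ‖(2 : ℚ_[p])‖ * ‖(2 : ℚ_[p])‖ * ‖b‖ ^ 2 := by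
        apply lt_mul_of_one_lt_right (by positivity)
        nlinarith
  have hne : 1 - a * c / b ^ 2 ≠ 0 := by
    intro h
    have h1 : a * c = b ^ 2 := by
      field_simp at h; linear_combination -h
    have h3 : ‖a‖ * ‖c‖ = ‖b‖ ^ 2 := by rw [← norm_mul, h1, norm_pow]
    have h2 := norm_two_le (p := p)
    have := mul_le_one₀ (hx.trans h2) (norm_nonneg c) (hy.trans h2)
    nlinarith
  obtain ⟨r, hr⟩ := hsq
  have hr0 : r ≠ 0 := by rintro rfl; rw [hr] at hne; simp at hne
  have hd : (b * r) ^ 2 = b ^ 2 - a * c := by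
    field_simp at hr
    linear_combination -hr
  have hyx : B y x = b := by rw [hB]
  have z : ∀ d, d ^ 2 = b ^ 2 - a * c → c • x + (d - b) • y = 0 := by
    intro d hd
    apply hA
    simp only [map_add, map_smul, LinearMap.add_apply, LinearMap.smul_apply, smul_eq_mul, hyx, ← ha, ← hc, ← hbdef]
    linear_combination c * hd
  have z1 := z (b * r) hd
  have z2 := z (-(b * r)) (by rw [neg_sq]; exact hd)
  have z3 : (2 * (b * r)) • y = 0 := by
    have : (2 * (b * r)) • y = (c • x + (b * r - b) • y) - (c • x + (-(b * r) - b) • y) := by module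
    rw [this, z1, z2, sub_zero]
  have hy0 : y = 0 := (smul_eq_zero.1 z3).resolve_left (mul_ne_zero two_ne_zero (mul_ne_zero hb0 hr0))
  apply hb0
  rw [hbdef, hy0, map_zero]

lemma enlarge (B : LinearMap.BilinForm ℚ_[p] V) (hB : ∀ x y, B x y = B y x)
    (hN : ∀ x, (∀ y, B x y = 0) → x = 0) (s : Set V) (hs : Ev B s) (e : V) (he : e ≠ 0) (hee : B e e = 0) :
    ∃ e f, B e e = 0 ∧ B f f = 0 ∧ B e f = 1 ∧ (∀ x ∈ s, ‖B x e‖ ≤ 1) ∧ (∀ x ∈ s, ‖B x f‖ ≤ 1) := by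
  obtain ⟨g, hg⟩ : ∃ g, B e g ≠ 0 := by
    by_contra! h; exact he (hN e h)
  -- isotropic partner
  obtain ⟨f0, hef0, hff0⟩ : ∃ f0, B e f0 ≠ 0 ∧ B f0 f0 = 0 := by
    refine ⟨g - (B g g / (2 * B e g)) • e, ?_, ?_⟩
    · simpa [hee] using hg
    · simp only [map_sub, map_smul, LinearMap.sub_apply, LinearMap.smul_apply, smul_eq_mul, hee, hB g e]
      field_simp; ring
  obtain ⟨C, hC⟩ : ∃ C, ∀ x ∈ s, ‖B x f0‖ ≤ C := by
    obtain ⟨C, hC⟩ := (hs.fin.image (fun x => ‖B x f0‖)).bddAbove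
    exact ⟨C, fun x hx => hC ⟨x, hx, rfl⟩⟩
  obtain ⟨t, ht0, ht⟩ : ∃ t : ℚ_[p], t ≠ 0 ∧ ‖t‖ * (|C| + 1) ≤ 1 := by
    obtain ⟨t, ht0, ht⟩ := NormedField.exists_norm_lt ℚ_[p] (r := 1 / (|C| + 1)) (by positivity)
    refine ⟨t, norm_pos_iff.1 ht0, ?_⟩
    rw [lt_div_iff₀ (by positivity)] at ht
    exact ht.le
  set f1 := t • f0 with hf1
  have hf1s : ∀ x ∈ s, ‖B x f1‖ ≤ 1 := by
    intro x hx
    rw [hf1, map_smul, smul_eq_mul, norm_mul]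
    refine le_trans (mul_le_mul_of_nonneg_left ?_ (norm_nonneg _)) ht
    linarith [hC x hx, le_abs_self C]
  have hf11 : B f1 f1 = 0 := by simp [hf1, hff0]
  obtain ⟨f2, hf2, hmax⟩ := Set.exists_max_image (insert f1 s) (fun x => ‖B x e‖) (hs.fin.insert f1) ⟨f1, by simp⟩
  have hf2e : B f2 e ≠ 0 := by
    intro h
    have := hmax f1 (by simp)
    rw [h, norm_zero, norm_le_zero_iff, hB, hf1, map_smul, smul_eq_mul] at this
    exact mul_ne_zero ht0 hef0 this
  have hf2d : ‖B f2 f2‖ ≤ ‖(2 : ℚ_[p])‖ := by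
    rcases hf2 with rfl | h
    · rw [hf11]; simp
    · exact hs.d _ h
  have hf2o : ∀ x ∈ s, ‖B x f2‖ ≤ 1 := by
    rcases hf2 with h | h
    · rw [h]; exact hf1s
    · exact fun x hx => hs.o x hx _ h
  set e' := (B f2 e)⁻¹ • e with he'
  have hee' : B e' e' = 0 := by simp [he', hee]
  have hf2e' : B f2 e' = 1 := by rw [he', map_smul, smul_eq_mul, inv_mul_cancel₀ hf2e]
  have hse : ∀ x ∈ s, ‖B x e'‖ ≤ 1 := by
    intro x hx
    rw [he', map_smul, smul_eq_mul, norm_mul, norm_inv, inv_mul_le_iff₀ (norm_pos_iff.2 hf2e), mul_one]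
    exact hmax x (by simp [hx])
  refine ⟨e', f2 - (B f2 f2 / 2) • e', hee', ?_, ?_, hse, ?_⟩
  · simp only [map_sub, map_smul, LinearMap.sub_apply, LinearMap.smul_apply, smul_eq_mul, hee', hB e' f2, hf2e']
    ring
  · simp only [map_sub, map_smul, smul_eq_mul, hee', hB e' f2, hf2e']
    ring
  · intro x hx
    rw [map_sub, map_smul, smul_eq_mul, sub_eq_add_neg]
    apply nonarch _ _ _ (hf2o x hx)
    rw [norm_neg, norm_mul, norm_div]
    apply mul_le_one₀ _ (norm_nonneg _) (hse x hx)
    exact div_le_one_of_le₀ hf2d (norm_nonneg _)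

lemma nm1 {a b : ℚ_[p]} (ha : ‖a‖ ≤ 1) (hb : ‖b‖ ≤ 1) : ‖a * b‖ ≤ 1 := by
  rw [norm_mul]; exact mul_le_one₀ ha (norm_nonneg _) hb

theorem thmA : ∀ (n : ℕ) (V : Type) [AddCommGroup V] [Module ℚ_[p] V] [FiniteDimensional ℚ_[p] V]
    (B : LinearMap.BilinForm ℚ_[p] V) (_ : ∀ x y, B x y = B y x)
    (_ : ∀ x, (∀ y, B x y = 0) → x = 0) (_ : Module.finrank ℚ_[p] V ≤ n) (s₁ s₂ : Set V)
    (_ : Ev B s₁) (_ : Ev B s₂), ∃ g : V →ₗ[ℚ_[p]] V, Pres B g ∧ ∀ x ∈ s₁, ∀ y ∈ s₂, ‖B x (g y)‖ ≤ 1 := by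
  intro n
  induction n with
  | zero =>
    intro V _ _ _ B hB hN hn s₁ s₂ h₁ h₂
    have : Subsingleton V := Module.finrank_zero_iff.1 (Nat.le_zero.1 hn)
    refine ⟨LinearMap.id, fun _ _ => rfl, fun x _ y _ => ?_⟩
    rw [Subsingleton.elim x 0]; simp
  | succ n ih =>
    intro V _ _ _ B hB hN hn s₁ s₂ h₁ h₂
    by_cases hA : ∀ x, B x x = 0 → x = 0
    · exact ⟨LinearMap.id, fun _ _ => rfl, fun x hx y hy => aniso B hB hA x y (h₁.d x hx) (h₂.d y hy)⟩
    push Not at hA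
    obtain ⟨e0, hee0, he0⟩ := hA
    obtain ⟨e, f, hee, hff, hef, hse, hsf⟩ := enlarge B hB hN s₁ h₁ e0 he0 hee0
    obtain ⟨e', f', hee', hff', hef', hse', hsf'⟩ := enlarge B hB hN s₂ h₂ e0 he0 hee0
    obtain ⟨σ, hσ, hσe, hσf⟩ := witt2 B hB e' f' e f hee' hff' hef' hee hff hef
    have hfe : B f e = 1 := by rw [hB]; exact hef
    let W : Submodule ℚ_[p] V := LinearMap.ker (B e) ⊓ LinearMap.ker (B f)
    have hWe : ∀ w : W, B w e = 0 := fun w => by rw [hB]; exact w.2.1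
    have hWf : ∀ w : W, B w f = 0 := fun w => by rw [hB]; exact w.2.2
    have hWe' : ∀ w : W, B e w = 0 := fun w => w.2.1
    have hWf' : ∀ w : W, B f w = 0 := fun w => w.2.2
    let π : V →ₗ[ℚ_[p]] W := LinearMap.codRestrict W
      (LinearMap.id - (B f).smulRight e - (B e).smulRight f) (by
        intro x
        refine ⟨?_, ?_⟩
        · simp [hee, hef]
        · simp [hff, hfe])
    have hπ : ∀ x, ((π x : W) : V) = x - B f x • e - B e x • f := fun x => rfl
    let BW : LinearMap.BilinForm ℚ_[p] W := B.compl₁₂ W.subtype W.subtype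
    have hBW : ∀ u v : W, BW u v = B u v := fun u v => rfl
    have hππ : ∀ x y, BW (π x) (π y) = B x y - B f x * B e y - B e x * B f y := by
      intro x y
      rw [hBW, hπ y, map_sub, map_sub, map_smul, map_smul, hWe, hWf, hπ x]
      simp only [map_sub, map_smul, LinearMap.sub_apply, LinearMap.smul_apply, smul_eq_mul]
      ring
    have evW : ∀ s : Set V, s.Finite → (∀ v ∈ s, ‖B v v‖ ≤ ‖(2 : ℚ_[p])‖) →
        (∀ v ∈ s, ∀ w ∈ s, ‖B v w‖ ≤ 1) → (∀ x ∈ s, ‖B x e‖ ≤ 1) → (∀ x ∈ s, ‖B x f‖ ≤ 1) →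
        Ev BW (π '' s) := by
      intro s hfin hd ho he hf
      refine ⟨hfin.image _, ?_, ?_⟩
      · rintro _ ⟨v, hv, rfl⟩
        rw [hππ, hB f v, hB e v, show B v v - B v f * B v e - B v e * B v f =
          B v v + -(2 * (B v f * B v e)) by ring]
        apply nonarch _ _ _ (hd v hv)
        rw [norm_neg, norm_mul]
        exact mul_le_of_le_one_right (norm_nonneg _) (nm1 (hf v hv) (he v hv))
      · rintro _ ⟨v, hv, rfl⟩ _ ⟨w, hw, rfl⟩
        rw [hππ, hB f v, hB e v, hB f w, hB e w, sub_eq_add_neg, sub_eq_add_neg]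
        apply nonarch
        · apply nonarch _ _ _ (ho v hv w hw)
          rw [norm_neg]; exact nm1 (hf v hv) (he w hw)
        · rw [norm_neg]; exact nm1 (he v hv) (hf w hw)
    have hs2e : ∀ y ∈ s₂, ‖B (σ y) e‖ ≤ 1 := fun y hy => by rw [← hσe, hσ]; exact hse' y hy
    have hs2f : ∀ y ∈ s₂, ‖B (σ y) f‖ ≤ 1 := fun y hy => by rw [← hσf, hσ]; exact hsf' y hy
    have hE1 := evW s₁ h₁.fin h₁.d h₁.o hse hsf
    have hE2 := evW (σ '' s₂) (h₂.fin.image _)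
      (by rintro _ ⟨v, hv, rfl⟩; rw [hσ]; exact h₂.d v hv)
      (by rintro _ ⟨v, hv, rfl⟩ _ ⟨w, hw, rfl⟩; rw [hσ]; exact h₂.o v hv w hw)
      (by rintro _ ⟨v, hv, rfl⟩; exact hs2e v hv)
      (by rintro _ ⟨v, hv, rfl⟩; exact hs2f v hv)
    have hWN : ∀ x : W, (∀ y, BW x y = 0) → x = 0 := by
      intro x hx
      apply Subtype.ext
      apply hN
      intro y
      have h1 := hx (π y)
      rw [hBW, hπ, map_sub, map_sub, map_smul, map_smul, hWe, hWf] at h1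
      simpa using h1
    have hlt : Module.finrank ℚ_[p] W < Module.finrank ℚ_[p] V := by
      apply Submodule.finrank_lt
      intro h
      have : e ∈ W := by rw [h]; trivial
      have h2 : B f e = 0 := this.2
      rw [hfe] at h2
      exact one_ne_zero h2
    obtain ⟨g', hg', hgb⟩ := ih W BW (fun x y => hB _ _) hWN (by omega) _ _ hE1 hE2
    let g : V →ₗ[ℚ_[p]] V := W.subtype ∘ₗ g' ∘ₗ π + (B f).smulRight e + (B e).smulRight f
    have hg : ∀ x, g x = (g' (π x) : V) + B f x • e + B e x • f := fun x => rfl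
    have hgP : Pres B g := by
      intro u v
      have h1 : B (g' (π u)) (g' (π v)) = B u v - B f u * B e v - B e u * B f v := by
        rw [← hππ, ← hg', hBW]
      rw [hg, hg]
      simp only [map_add, map_smul, LinearMap.add_apply, LinearMap.smul_apply, smul_eq_mul, hWe, hWf, hWe', hWf',
        hee, hff, hef, hfe, h1]
      ring
    refine ⟨g ∘ₗ σ, hgP.comp hσ, ?_⟩
    intro x hx y hy
    have h1 := hgb (π x) ⟨x, hx, rfl⟩ (π (σ y)) ⟨σ y, ⟨y, hy, rfl⟩, rfl⟩
    have h2 : BW (π x) (g' (π (σ y))) = B x (g' (π (σ y))) := by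
      rw [hBW, hπ]
      simp only [map_sub, map_smul, LinearMap.sub_apply, LinearMap.smul_apply, hWe', hWf']
      simp
    rw [LinearMap.comp_apply, hg, map_add, map_add, map_smul, map_smul, smul_eq_mul, smul_eq_mul, ← h2]
    apply nonarch
    · apply nonarch _ _ _ h1
      rw [hB f]; exact nm1 (hs2f y hy) (hse x hx)
    · rw [hB e]; exact nm1 (hs2e y hy) (hsf x hx)

end lat
end Bur

namespace Bur
variable {p : ℕ} [Fact p.Prime]

lemma scale_exists (C : ℝ) : ∃ c : ℚ_[p], c ≠ 0 ∧ ‖c‖ ≤ 1 ∧ ‖c‖ * C ≤ 1 := by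
  have hp : ‖(p : ℚ_[p])‖ < 1 := Padic.norm_p_lt_one
  have h0 : (p : ℚ_[p]) ≠ 0 := by exact_mod_cast (Fact.out : p.Prime).ne_zero
  obtain ⟨N, hN⟩ := exists_pow_lt_of_lt_one (show (0:ℝ) < 1 / (|C| + 1) by positivity) hp
  refine ⟨(p : ℚ_[p]) ^ N, pow_ne_zero _ h0, ?_, ?_⟩
  · rw [norm_pow]; exact pow_le_one₀ (norm_nonneg _) hp.le
  · rw [norm_pow]
    have : (‖(p : ℚ_[p])‖ ^ N) * (|C| + 1) ≤ 1 := by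
      have := (lt_div_iff₀ (by positivity)).1 hN
      exact this.le
    have h2 : C ≤ |C| + 1 := by linarith [le_abs_self C]
    exact (mul_le_mul_of_nonneg_left h2 (by positivity)).trans this

lemma span_int {V : Type} [AddCommGroup V] [Module ℚ_[p] V] [Module ℤ_[p] V] [IsScalarTower ℤ_[p] ℚ_[p] V]
    (B : LinearMap.BilinForm ℚ_[p] V) (s : Set V)
    (h : ∀ x ∈ s, ∀ y ∈ s, ‖B x y‖ ≤ 1) :
    ∀ x ∈ Submodule.span ℤ_[p] s, ∀ y ∈ Submodule.span ℤ_[p] s, ‖B x y‖ ≤ 1 := by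
  have sm : ∀ (a : ℤ_[p]) (v : V), a • v = (a : ℚ_[p]) • v := fun a v => by
    rw [← algebraMap_smul ℚ_[p] a v]; rfl
  intro x hx y hy
  induction hx using Submodule.span_induction with
  | mem x hx =>
    induction hy using Submodule.span_induction with
    | mem y hy => exact h x hx y hy
    | zero => simp
    | add y z _ _ h1 h2 => rw [map_add]; exact nonarch _ _ _ h1 h2
    | smul a y _ h1 =>
      rw [sm, map_smul, smul_eq_mul, norm_mul]
      exact mul_le_one₀ (PadicInt.norm_le_one a) (norm_nonneg _) h1
  | zero => simp
  | add y z _ _ h1 h2 => rw [map_add, LinearMap.add_apply]; exact nonarch _ _ _ h1 h2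
  | smul a y _ h1 =>
    rw [sm, map_smul, LinearMap.smul_apply, smul_eq_mul, norm_mul]
    exact mul_le_one₀ (PadicInt.norm_le_one a) (norm_nonneg _) h1

lemma latt (n : ℕ) (B : LinearMap.BilinForm ℚ_[p] (Fin n → ℚ_[p])) (s : Set (Fin n → ℚ_[p]))
    (hs : s.Finite) (h : ∀ x ∈ s, ∀ y ∈ s, ‖B x y‖ ≤ 1) :
    ∃ b : Module.Basis (Fin n) ℚ_[p] (Fin n → ℚ_[p]), (∀ i j, ‖B (b i) (b j)‖ ≤ 1) ∧
      ∀ x ∈ s, ∀ i, ‖b.repr x i‖ ≤ 1 := by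
  classical
  let e : Fin n → (Fin n → ℚ_[p]) := fun i => Pi.single i 1
  let F : Set (Fin n → ℚ_[p]) := s ∪ Set.range e
  have hF : F.Finite := hs.union (Set.finite_range e)
  obtain ⟨C, hC⟩ : ∃ C : ℝ, ∀ x ∈ F, ∀ y ∈ F, ‖B x y‖ ≤ C := by
    obtain ⟨C, hC⟩ := ((hF.prod hF).image (fun q => ‖B q.1 q.2‖)).bddAbove
    exact ⟨C, fun x hx y hy => hC ⟨(x, y), ⟨hx, hy⟩, rfl⟩⟩
  obtain ⟨c, hc0, hc1, hcC⟩ := scale_exists (p := p) C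
  let t : Set (Fin n → ℚ_[p]) := s ∪ Set.range (fun i => c • e i)
  have ht : t.Finite := hs.union (Set.finite_range _)
  have key : ∀ x ∈ F, ∀ y ∈ F, ‖c‖ * ‖B x y‖ ≤ 1 := fun x hx y hy =>
    (mul_le_mul_of_nonneg_left (hC x hx y hy) (norm_nonneg _)).trans hcC
  have hti : ∀ x ∈ t, ∀ y ∈ t, ‖B x y‖ ≤ 1 := by
    rintro x (hx | ⟨i, rfl⟩) y (hy | ⟨j, rfl⟩)
    · exact h x hx y hy
    · simpa using key x (Or.inl hx) (e j) (Or.inr ⟨j, rfl⟩)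
    · simpa using key (e i) (Or.inr ⟨i, rfl⟩) y (Or.inl hy)
    · have := key (e i) (Or.inr ⟨i, rfl⟩) (e j) (Or.inr ⟨j, rfl⟩)
      simp only [map_smul, LinearMap.smul_apply, smul_eq_mul, norm_mul]
      exact mul_le_one₀ hc1 (by positivity) this
  let M : Submodule ℤ_[p] (Fin n → ℚ_[p]) := Submodule.span ℤ_[p] t
  have hM : Submodule.IsLattice ℚ_[p] M := by
    refine ⟨Submodule.fg_span ht, ?_⟩
    rw [eq_top_iff]
    intro x _
    have hx : x = ∑ i, (x i * c⁻¹) • (c • e i) := by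
      ext j
      simp [e, Finset.sum_apply, Pi.single_apply, hc0, Finset.sum_ite_eq]
    rw [hx]
    refine Submodule.sum_mem _ fun i _ => Submodule.smul_mem _ _ (Submodule.subset_span ?_)
    exact Submodule.subset_span (Or.inr ⟨i, rfl⟩)
  have hfr := Submodule.IsLattice.finrank_of_pi ℚ_[p] M
  have := Submodule.IsLattice.free ℚ_[p] M
  rw [Fintype.card_fin] at hfr
  let b0 : Module.Basis (Fin n) ℤ_[p] M := Module.finBasisOfFinrankEq ℤ_[p] M hfr
  let b := b0.extendOfIsLattice ℚ_[p]
  have hb : ∀ i, b i = (b0 i).1 := fun i => Module.Basis.extendOfIsLattice_apply _ _ _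
  refine ⟨b, fun i j => ?_, fun x hx i => ?_⟩
  · rw [hb, hb]
    exact span_int B t hti _ (b0 i).2 _ (b0 j).2
  · have hxM : x ∈ M := Submodule.subset_span (Or.inl hx)
    have h1 := congrArg Subtype.val (b0.sum_repr ⟨x, hxM⟩)
    have h2 : ∑ i, ((b0.repr ⟨x, hxM⟩ i : ℤ_[p]) : ℚ_[p]) • b i = x := by
      refine Eq.trans ?_ h1
      simp only [Submodule.coe_sum, hb]
      refine Finset.sum_congr rfl fun i _ => ?_
      rw [Submodule.coe_smul, ← algebraMap_smul ℚ_[p]]; rfl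
    have h3 : b.repr x i = ((b0.repr ⟨x, hxM⟩ i : ℤ_[p]) : ℚ_[p]) := by
      conv_lhs => rw [← h2]
      rw [Module.Basis.repr_sum_self]
    rw [h3]; exact PadicInt.norm_le_one _

end Bur

namespace Bur
variable {p : ℕ} [Fact p.Prime]

lemma entry {K : Type} [Field K] {n m k : ℕ} (V : Matrix (Fin n) (Fin n) K) (S : Matrix (Fin n) (Fin m) K)
    (T : Matrix (Fin n) (Fin k) K) (i : Fin m) (j : Fin k) :
    (Sᵀ * V * T) i j = Matrix.toBilin' V (Sᵀ i) (Tᵀ j) := by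
  rw [Matrix.toBilin'_apply', Matrix.mul_assoc, Matrix.mul_apply]
  rfl

lemma toBilin_symm {K : Type} [Field K] {n : ℕ} (V : Matrix (Fin n) (Fin n) K) (h : V.IsSymm) (x y) :
    Matrix.toBilin' V x y = Matrix.toBilin' V y x := by
  rw [Matrix.toBilin'_apply', Matrix.toBilin'_apply', dotProduct_comm, ← Matrix.vecMul_transpose, h.eq,
    Matrix.dotProduct_mulVec]

lemma toBilin_nondeg {K : Type} [Field K] {n : ℕ} (V : Matrix (Fin n) (Fin n) K) (h : V.det ≠ 0) (x)
    (hx : ∀ y, Matrix.toBilin' V x y = 0) : x = 0 :=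
  (LinearMap.BilinForm.nondegenerate_toBilin'_of_det_ne_zero' V h).1 x hx

lemma even_diag {m : ℕ} {ℓ : Matrix (Fin m) (Fin m) ℤ} (h : IsEvenForm ℓ) (i : Fin m) : 2 ∣ ℓ i i := by
  have := h (Pi.single i 1)
  simpa using this

lemma ev_of {n m : ℕ} (V : Matrix (Fin n) (Fin n) ℚ_[p]) (S : Matrix (Fin n) (Fin m) ℚ_[p])
    (ℓ : Matrix (Fin m) (Fin m) ℤ) (h : IsEvenForm ℓ) (hS : Sᵀ * V * S = ℓ.map (Int.cast : ℤ → ℚ_[p])) :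
    Ev (Matrix.toBilin' V) (Set.range Sᵀ) := by
  have e : ∀ i j, Matrix.toBilin' V (Sᵀ i) (Sᵀ j) = (ℓ i j : ℚ_[p]) := fun i j => by
    rw [← entry, hS]; rfl
  refine ⟨Set.finite_range _, ?_, ?_⟩
  · rintro _ ⟨i, rfl⟩
    rw [e]
    obtain ⟨c, hc⟩ := even_diag h i
    rw [hc]; push_cast
    rw [norm_mul]
    exact mul_le_of_le_one_right (norm_nonneg _) (Padic.norm_int_le_one c)
  · rintro _ ⟨i, rfl⟩ _ ⟨j, rfl⟩
    rw [e]; exact Padic.norm_int_le_one _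

lemma dir21 {n m : ℕ} {ℓ₁ ℓ₂ : Matrix (Fin m) (Fin m) ℤ} (he₁ : IsEvenForm ℓ₁) (he₂ : IsEvenForm ℓ₂)
    (h : BuriedIn ℚ_[p] n ℓ₁ ℓ₂) : BuriedIn ℤ_[p] n ℓ₁ ℓ₂ := by
  obtain ⟨V, hV, hd, ⟨S₁, hS₁⟩, ⟨S₂, hS₂⟩⟩ := h
  have ev1 := ev_of V S₁ ℓ₁ he₁ hS₁
  have ev2 := ev_of V S₂ ℓ₂ he₂ hS₂
  set B := Matrix.toBilin' V with hB
  have sym : ∀ x y, B x y = B y x := toBilin_symm V hV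
  obtain ⟨g, hg, hi⟩ := thmA n (Fin n → ℚ_[p]) B sym (toBilin_nondeg V hd) (by simp) _ _ ev1 ev2
  obtain ⟨b, hb, hr⟩ := latt n B (Set.range S₁ᵀ ∪ g '' Set.range S₂ᵀ)
    (ev1.fin.union (ev2.fin.image _)) (by
      rintro x (hx | ⟨x, hx, rfl⟩) y (hy | ⟨y, hy, rfl⟩)
      · exact ev1.o x hx y hy
      · exact hi x hx y hy
      · rw [sym]; exact hi y hy x hx
      · rw [hg]; exact ev2.o x hx y hy)
  let L : Matrix (Fin n) (Fin n) ℤ_[p] := fun i j => ⟨B (b i) (b j), hb i j⟩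
  have hL : L.map (PadicInt.Coe.ringHom (p := p)) = LinearMap.BilinForm.toMatrix b B := by
    ext i j; rw [LinearMap.BilinForm.toMatrix_apply]; rfl
  have fin : ∀ (X : Fin m → (Fin n → ℚ_[p])) (ℓ : Matrix (Fin m) (Fin m) ℤ)
      (_ : ∀ j i, ‖b.repr (X j) i‖ ≤ 1) (_ : ∀ i j, B (X i) (X j) = (ℓ i j : ℚ_[p])),
      ∃ T : Matrix (Fin n) (Fin m) ℤ_[p], Tᵀ * L * T = ℓ.map (Int.cast : ℤ → ℤ_[p]) := by
    intro X ℓ h1 h2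
    let T : Matrix (Fin n) (Fin m) ℤ_[p] := fun i j => ⟨b.repr (X j) i, h1 j i⟩
    refine ⟨T, ?_⟩
    ext i j
    have h3 := h2 i j
    rw [← LinearMap.sum_repr_mul_repr_mul b b (X i) (X j)] at h3
    have h4 : (((Tᵀ * L * T) i j : ℤ_[p]) : ℚ_[p]) = (ℓ i j : ℚ_[p]) := by
      rw [← h3, Finsupp.sum_fintype _ _ (by simp)]
      have e1 : ∀ i', ((b.repr (X j)).sum fun k yj => (b.repr (X i) i') • yj • B (b i') (b k)) =
          ∑ k, b.repr (X i) i' * (b.repr (X j) k * B (b i') (b k)) := fun i' => by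
        rw [Finsupp.sum_fintype _ _ (by simp)]; rfl
      rw [Finset.sum_congr rfl fun i' _ => e1 i', Finset.sum_comm]
      change PadicInt.Coe.ringHom ((Tᵀ * L * T) i j) = _
      rw [Matrix.mul_apply, map_sum]
      refine Finset.sum_congr rfl fun k _ => ?_
      rw [map_mul, Matrix.mul_apply, map_sum, Finset.sum_mul]
      refine Finset.sum_congr rfl fun i' _ => ?_
      rw [map_mul]
      change b.repr (X i) i' * B (b i') (b k) * b.repr (X j) k = _
      ring
    apply Subtype.ext
    rw [h4]; simp
  refine ⟨L, ?_, ?_, ?_, ?_⟩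
  · ext i j; exact congrArg (fun z : ℤ_[p] => z) (Subtype.ext (sym _ _))
  · intro h0
    have h1 := (LinearMap.BilinForm.nondegenerate_iff_det_ne_zero b).1
      (LinearMap.BilinForm.nondegenerate_toBilin'_of_det_ne_zero' V hd)
    apply h1
    rw [← hB, ← hL]
    have := RingHom.map_det (PadicInt.Coe.ringHom (p := p)) L
    rw [h0, map_zero] at this
    exact this.symm
  · refine fin S₁ᵀ ℓ₁ (fun j i => hr _ (Or.inl ⟨j, rfl⟩) i) fun i j => ?_
    rw [hB, ← entry, hS₁]; rfl
  · refine fin (fun j => g (S₂ᵀ j)) ℓ₂ (fun j i => hr _ (Or.inr ⟨_, ⟨j, rfl⟩, rfl⟩) i) fun i j => ?_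
    rw [hg, hB, ← entry, hS₂]; rfl

lemma dir12 {n m : ℕ} {ℓ₁ ℓ₂ : Matrix (Fin m) (Fin m) ℤ}
    (h : BuriedIn ℤ_[p] n ℓ₁ ℓ₂) : BuriedIn ℚ_[p] n ℓ₁ ℓ₂ := by
  obtain ⟨L, hL, hd, ⟨T₁, hT₁⟩, ⟨T₂, hT₂⟩⟩ := h
  let f := PadicInt.Coe.ringHom (p := p)
  have key : ∀ (T : Matrix (Fin n) (Fin m) ℤ_[p]) (ℓ : Matrix (Fin m) (Fin m) ℤ),
      Tᵀ * L * T = ℓ.map (Int.cast : ℤ → ℤ_[p]) →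
      (T.map f)ᵀ * L.map f * T.map f = ℓ.map (Int.cast : ℤ → ℚ_[p]) := by
    intro T ℓ h
    have := congrArg (fun M => M.map f) h
    simp only [Matrix.map_mul, Matrix.transpose_map] at this
    rw [this]; ext i j; simp
  refine ⟨L.map f, hL.map _, ?_, ⟨_, key _ _ hT₁⟩, ⟨_, key _ _ hT₂⟩⟩
  have := RingHom.map_det f L
  intro h0
  apply hd
  have h1 : f L.det = 0 := by rw [this]; exact h0
  exact Subtype.ext h1

end Bur

namespace Bur
variable {p : ℕ} [Fact p.Prime]

lemma diagz {K : Type} [Field K] [CharZero K] {m : ℕ} (A : Matrix (Fin m) (Fin m) K) (hA : A.IsSymm) :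
    ∃ (P : Matrix (Fin m) (Fin m) K) (a : Fin m → K), IsUnit P.det ∧ Pᵀ * A * P = diagonal a := by
  have : Invertible (2 : K) := invertibleOfNonzero two_ne_zero
  obtain ⟨v, hv⟩ := LinearMap.BilinForm.exists_orthogonal_basis (B := Matrix.toBilin' A)
    ⟨fun x y => toBilin_symm A hA x y⟩
  have hf : Module.finrank K (Fin m → K) = m := by simp
  let w := v.reindex (finCongr hf)
  let P : Matrix (Fin m) (Fin m) K := fun i j => w j i
  refine ⟨P, fun i => Matrix.toBilin' A (w i) (w i), ?_, ?_⟩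
  · have : P = (Pi.basisFun K (Fin m)).toMatrix w := by ext i j; simp [P, Module.Basis.toMatrix_apply]
    rw [this, ← Module.Basis.det_apply]
    exact Module.Basis.isUnit_det _ _
  · ext i j
    rw [entry]
    change Matrix.toBilin' A (w i) (w j) = _
    by_cases h : i = j
    · subst h; simp
    · rw [diagonal_apply_ne _ h]
      have := hv (i := (finCongr hf).symm i) (j := (finCongr hf).symm j) (by simpa using h)
      simpa [w, Module.Basis.reindex_apply] using this

lemma of_rel {K : Type} [Field K] {n m : ℕ} (d : Fin n → K) (a : Fin m → K)
    (h : Rel (List.ofFn d) (List.ofFn a)) :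
    ∃ S : Matrix (Fin n) (Fin m) K, Sᵀ * diagonal d * S = diagonal a := by
  obtain ⟨vs, ⟨h1, h2⟩, -⟩ := h (Fin n → K) (Matrix.toBilin' (diagonal d))
    (toBilin_symm _ (by simp [Matrix.IsSymm])) (List.ofFn fun i => Pi.single i 1) (by
      constructor
      · rw [List.forall₂_iff_get]
        refine ⟨by simp, fun i h1 h2 => ?_⟩
        simp [Matrix.toBilin'_apply']
      · rw [List.pairwise_ofFn]
        intro i j hij
        simp [Matrix.toBilin'_apply', hij.ne'])
  have hl : vs.length = m := by simpa using h1.length_eq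
  let v : Fin m → (Fin n → K) := fun i => vs.get (i.cast hl.symm)
  let S : Matrix (Fin n) (Fin m) K := fun k i => v i k
  refine ⟨S, ?_⟩
  ext i j
  rw [entry]
  change Matrix.toBilin' (diagonal d) (v i) (v j) = _
  rw [List.forall₂_iff_get] at h1
  rw [List.pairwise_iff_get] at h2
  rcases lt_trichotomy i j with h | h | h
  · rw [diagonal_apply_ne _ h.ne]
    exact h2 _ _ (by simpa using h)
  · subst h
    have := h1.2 i (by simp [hl]) (by simp)
    simpa [v] using this
  · rw [diagonal_apply_ne _ h.ne', toBilin_symm _ (by simp [Matrix.IsSymm])]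
    exact h2 _ _ (by simpa using h)

lemma undiag {K : Type} [Field K] {n m : ℕ} (V : Matrix (Fin n) (Fin n) K) (S : Matrix (Fin n) (Fin m) K)
    (A P D : Matrix (Fin m) (Fin m) K) (hP : IsUnit P.det) (h : Pᵀ * A * P = D) (hS : Sᵀ * V * S = D) :
    (S * P⁻¹)ᵀ * V * (S * P⁻¹) = A := by
  have h1 : P * P⁻¹ = 1 := Matrix.mul_nonsing_inv _ hP
  have h2 : (P⁻¹)ᵀ * Pᵀ = 1 := by rw [← transpose_mul, h1, transpose_one]
  calc (S * P⁻¹)ᵀ * V * (S * P⁻¹) = (P⁻¹)ᵀ * (Sᵀ * V * S) * P⁻¹ := by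
        rw [transpose_mul]; simp only [Matrix.mul_assoc]
    _ = ((P⁻¹)ᵀ * Pᵀ) * A * (P * P⁻¹) := by rw [hS, ← h]; simp only [Matrix.mul_assoc]
    _ = A := by rw [h1, h2]; simp

lemma pd_det {m : ℕ} {ℓ : Matrix (Fin m) (Fin m) ℤ} (h : IsPDForm ℓ) : ℓ.det ≠ 0 := by
  intro h0
  obtain ⟨v, hv, hv0⟩ := Matrix.exists_mulVec_eq_zero_iff.2 h0
  have := h.2 v hv
  rw [hv0] at this
  simp at this

lemma map_det_ {m : ℕ} (ℓ : Matrix (Fin m) (Fin m) ℤ) :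
    (ℓ.map (Int.cast : ℤ → ℚ_[p])).det = (ℓ.det : ℚ_[p]) := by
  have := RingHom.map_det (Int.castRingHom ℚ_[p]) ℓ
  exact this.symm

lemma dir32 {n m : ℕ} (hm : 0 < m) (hmn : m ≤ n) {ℓ₁ ℓ₂ : Matrix (Fin m) (Fin m) ℤ}
    (h₁ : IsPDForm ℓ₁) (h₂ : IsPDForm ℓ₂)
    (h : (∃ U : Matrix (Fin m) (Fin m) ℚ_[p], IsUnit U.det ∧
          Uᵀ * ℓ₁.map (Int.cast : ℤ → ℚ_[p]) * U = ℓ₂.map (Int.cast : ℤ → ℚ_[p])) ∨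
        (¬ IsSquare ((ℓ₁.det * ℓ₂.det : ℤ) : ℚ_[p]) ∧ n = m + 1) ∨
        m + 2 ≤ n) : BuriedIn ℚ_[p] n ℓ₁ ℓ₂ := by
  obtain ⟨P, a, hP, ha⟩ := diagz (ℓ₁.map (Int.cast : ℤ → ℚ_[p])) (h₁.1.map _)
  obtain ⟨Q, b, hQ, hb⟩ := diagz (ℓ₂.map (Int.cast : ℤ → ℚ_[p])) (h₂.1.map _)
  have pa : (List.ofFn a).prod = (ℓ₁.det : ℚ_[p]) * P.det ^ 2 := by
    rw [List.prod_ofFn, ← det_diagonal, ← ha, det_mul, det_mul, det_transpose, map_det_]; ring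
  have pb : (List.ofFn b).prod = (ℓ₂.det : ℚ_[p]) * Q.det ^ 2 := by
    rw [List.prod_ofFn, ← det_diagonal, ← hb, det_mul, det_mul, det_transpose, map_det_]; ring
  have ha0 : (List.ofFn a).prod ≠ 0 := by
    rw [pa]; exact mul_ne_zero (by exact_mod_cast pd_det h₁) (pow_ne_zero _ hP.ne_zero)
  have hb0 : (List.ofFn b).prod ≠ 0 := by
    rw [pb]; exact mul_ne_zero (by exact_mod_cast pd_det h₂) (pow_ne_zero _ hQ.ne_zero)
  have fin : ∀ (l : List ℚ_[p]), l.length = n → l.prod ≠ 0 → Rel l (List.ofFn a) →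
      ∃ V : Matrix (Fin n) (Fin n) ℚ_[p], V.IsSymm ∧ V.det ≠ 0 ∧
      (∃ T : Matrix (Fin n) (Fin m) ℚ_[p], Tᵀ * V * T = ℓ₁.map (Int.cast : ℤ → ℚ_[p])) ∧
      (Rel l (List.ofFn b) → ∃ T : Matrix (Fin n) (Fin m) ℚ_[p],
        Tᵀ * V * T = ℓ₂.map (Int.cast : ℤ → ℚ_[p])) := by
    intro l hl hl0 hr
    obtain ⟨d, rfl⟩ : ∃ d : Fin n → ℚ_[p], l = List.ofFn d := by
      subst hl; exact ⟨l.get, by simp⟩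
    refine ⟨diagonal d, by simp [Matrix.IsSymm], by rwa [det_diagonal, ← List.prod_ofFn], ?_, ?_⟩
    · obtain ⟨S, hS⟩ := of_rel _ _ hr
      exact ⟨_, undiag _ S _ P _ hP ha hS⟩
    · intro hr'
      obtain ⟨S, hS⟩ := of_rel _ _ hr'
      exact ⟨_, undiag _ S _ Q _ hQ hb hS⟩
  have fin2 : (∃ l : List ℚ_[p], l.length = n ∧ l.prod ≠ 0 ∧ Rel l (List.ofFn a) ∧ Rel l (List.ofFn b)) →
      BuriedIn ℚ_[p] n ℓ₁ ℓ₂ := by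
    rintro ⟨l, h1, h2, h3, h4⟩
    obtain ⟨V, hV, hd, hT, hT'⟩ := fin l h1 h2 h3
    exact ⟨V, hV, hd, hT, hT' h4⟩
  rcases h with ⟨U, hU, hUe⟩ | ⟨hs, rfl⟩ | hn
  · obtain ⟨l, h1, h2, h3, -⟩ := list_pad (List.ofFn a) (List.ofFn a) m (n - m)
      ⟨List.ofFn a, by simp, ha0, Rel.refl _, Rel.refl _⟩
    obtain ⟨V, hV, hd, ⟨T, hT⟩, -⟩ := fin l (by omega) h2 h3
    refine ⟨V, hV, hd, ⟨T, hT⟩, T * U, ?_⟩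
    rw [← hUe, ← hT, transpose_mul]; simp only [Matrix.mul_assoc]
  · apply fin2
    obtain ⟨k, rfl⟩ : ∃ k, m = k + 1 := ⟨m - 1, by omega⟩
    refine list1 _ _ k (by simp) (by simp) ?_
    rw [pa, pb, show (ℓ₁.det : ℚ_[p]) * P.det ^ 2 * ((ℓ₂.det : ℚ_[p]) * Q.det ^ 2) =
      ((ℓ₁.det * ℓ₂.det : ℤ) : ℚ_[p]) * (P.det * Q.det) ^ 2 by push_cast; ring,
      sq_mul_iff (mul_ne_zero hP.ne_zero hQ.ne_zero)]
    exact hs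
  · apply fin2
    have := list_pad _ _ _ (n - (m + 2)) (list2 (List.ofFn a) (List.ofFn b) m (by simp) (by simp) ha0 hb0)
    rwa [show m + 2 + (n - (m + 2)) = n by omega] at this

end Bur

namespace Bur
variable {p : ℕ} [Fact p.Prime]

lemma compl_vec {K : Type} [Field K] {m : ℕ} (V : Matrix (Fin (m+1)) (Fin (m+1)) K)
    (hV : V.IsSymm) (hd : V.det ≠ 0)
    (S : Matrix (Fin (m+1)) (Fin m) K) (A : Matrix (Fin m) (Fin m) K) (hA : A.det ≠ 0)
    (hS : Sᵀ * V * S = A) :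
    ∃ (z : Fin (m+1) → K) (q r : K), q ≠ 0 ∧ r ≠ 0 ∧ Matrix.toBilin' V z z = q ∧
      V.det * r ^ 2 = A.det * q ∧ (∀ i, Matrix.toBilin' V (Sᵀ i) z = 0) ∧
      ∀ x, Matrix.toBilin' V x z = 0 → ∃ u : Fin m → K, x = S *ᵥ u := by
  obtain ⟨z, hz, hz0⟩ : ∃ z : Fin (m+1) → K, z ≠ 0 ∧ (Sᵀ * V) *ᵥ z = 0 := by
    by_contra! hcon
    have hinj : Function.Injective (Sᵀ * V).mulVecLin := by
      rw [injective_iff_map_eq_zero]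
      intro z hz
      by_contra h0
      exact hcon z h0 hz
    have := LinearMap.finrank_le_finrank_of_injective hinj
    simp at this
  have hSz : ∀ i, Matrix.toBilin' V (Sᵀ i) z = 0 := fun i => by
    have := congrFun hz0 i
    rw [Matrix.toBilin'_apply', Matrix.dotProduct_mulVec]
    rw [Pi.zero_apply] at this
    rw [← this]; rfl
  have hAinj : ∀ u : Fin m → K, A *ᵥ u = 0 → u = 0 := fun u hu => by
    by_contra h0
    exact hA (Matrix.exists_mulVec_eq_zero_iff.1 ⟨u, h0, hu⟩)
  let Z : Matrix (Fin (m+1)) (Fin 1) K := Matrix.of fun k _ => z k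
  have hSZ : Sᵀ * V * Z = 0 := by
    ext i j
    rw [entry]; exact hSz i
  have hZS : Zᵀ * V * S = 0 := by
    have := congrArg Matrix.transpose hSZ
    rw [transpose_mul, transpose_mul, transpose_transpose, hV.eq, transpose_zero] at this
    rw [← this, Matrix.mul_assoc]
  let G : Matrix (Fin (m+1)) (Fin m ⊕ Fin 1) K := Matrix.fromCols S Z
  have hG : Gᵀ * V * G = Matrix.fromBlocks A 0 0 (Zᵀ * V * Z) := by
    simp only [G]
    rw [Matrix.transpose_fromCols, Matrix.fromRows_mul, Matrix.fromRows_mul_fromCols, hS, hSZ, hZS]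
  let e : Fin m ⊕ Fin 1 ≃ Fin (m+1) := finSumFinEquiv
  let G2 : Matrix (Fin (m+1)) (Fin (m+1)) K := G.submatrix id e.symm
  have hG2 : G2ᵀ * V * G2 = (Matrix.fromBlocks A 0 0 (Zᵀ * V * Z)).submatrix e.symm e.symm := by
    rw [← hG]; rfl
  have hmul : ∀ w : Fin (m+1) → K, G2 *ᵥ w = S *ᵥ (fun i => w (e (Sum.inl i))) + w (e (Sum.inr 0)) • z := by
    intro w
    have h1 : G2 *ᵥ w = G *ᵥ (w ∘ e) := by
      have := Matrix.submatrix_mulVec_equiv G w id e.symm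
      simpa using this
    rw [h1, Matrix.fromCols_mulVec]
    congr 1
    ext k
    simp [Matrix.mulVec, dotProduct, Z, mul_comm]
  have hdet : V.det * G2.det ^ 2 = A.det * Matrix.toBilin' V z z := by
    have := congrArg Matrix.det hG2
    rw [det_submatrix_equiv_self, det_fromBlocks_zero₂₁, det_mul, det_mul, det_transpose, det_fin_one, entry] at this
    rw [show Matrix.toBilin' V z z = Matrix.toBilin' V (Zᵀ 0) (Zᵀ 0) from rfl, ← this]; ring
  have hr : G2.det ≠ 0 := by
    intro h0
    obtain ⟨w, hw, hw0⟩ := Matrix.exists_mulVec_eq_zero_iff.2 h0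
    rw [hmul] at hw0
    have h1 := congrArg (fun x => (Sᵀ * V) *ᵥ x) hw0
    simp only [Matrix.mulVec_add, Matrix.mulVec_smul, hz0, Matrix.mulVec_mulVec, hS, smul_zero, add_zero,
      Matrix.mulVec_zero] at h1
    have h2 := hAinj _ h1
    rw [h2, Matrix.mulVec_zero, zero_add] at hw0
    have h3 := (smul_eq_zero.1 hw0).resolve_right hz
    apply hw
    ext i
    obtain ⟨j, rfl⟩ := e.surjective i
    rcases j with j | j
    · exact congrFun h2 j
    · rw [Subsingleton.elim j 0]; exact h3
  have hq : Matrix.toBilin' V z z ≠ 0 := by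
    intro h0
    rw [h0, mul_zero] at hdet
    exact mul_ne_zero hd (pow_ne_zero 2 hr) hdet
  refine ⟨z, _, G2.det, hq, hr, rfl, hdet, hSz, fun x hx => ?_⟩
  have hxw : x = G2 *ᵥ (G2⁻¹ *ᵥ x) := by
    rw [Matrix.mulVec_mulVec, Matrix.mul_nonsing_inv _ (isUnit_iff_ne_zero.2 hr), Matrix.one_mulVec]
  rw [hmul] at hxw
  set w := G2⁻¹ *ᵥ x
  refine ⟨fun i => w (e (Sum.inl i)), hxw.trans ?_⟩
  have hSu : ∀ u : Fin m → K, Matrix.toBilin' V (S *ᵥ u) z = 0 := fun u => by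
    rw [toBilin_symm V hV, Matrix.toBilin'_apply', Matrix.mulVec_mulVec, Matrix.dotProduct_mulVec]
    have : z ᵥ* (V * S) = (Sᵀ * V) *ᵥ z := by
      rw [← Matrix.mulVec_transpose, transpose_mul, hV.eq]
    rw [this, hz0, zero_dotProduct]
  rw [hxw, map_add, LinearMap.add_apply, hSu, map_smul, LinearMap.smul_apply, zero_add, smul_eq_mul] at hx
  rw [(mul_eq_zero.1 hx).resolve_right hq, zero_smul, add_zero]

lemma dir23 {n m : ℕ} (hmn : m ≤ n) {ℓ₁ ℓ₂ : Matrix (Fin m) (Fin m) ℤ}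
    (h₁ : IsPDForm ℓ₁) (h₂ : IsPDForm ℓ₂)
    (h : BuriedIn ℚ_[p] n ℓ₁ ℓ₂) : (∃ U : Matrix (Fin m) (Fin m) ℚ_[p], IsUnit U.det ∧
          Uᵀ * ℓ₁.map (Int.cast : ℤ → ℚ_[p]) * U = ℓ₂.map (Int.cast : ℤ → ℚ_[p])) ∨
        (¬ IsSquare ((ℓ₁.det * ℓ₂.det : ℤ) : ℚ_[p]) ∧ n = m + 1) ∨
        m + 2 ≤ n := by
  obtain ⟨V, hV, hd, ⟨S₁, hS₁⟩, ⟨S₂, hS₂⟩⟩ := h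
  have d₁ : (ℓ₁.map (Int.cast : ℤ → ℚ_[p])).det ≠ 0 := by
    rw [map_det_]; exact_mod_cast pd_det h₁
  have d₂ : (ℓ₂.map (Int.cast : ℤ → ℚ_[p])).det ≠ 0 := by
    rw [map_det_]; exact_mod_cast pd_det h₂
  have m₁ := map_det_ (p := p) ℓ₁
  have m₂ := map_det_ (p := p) ℓ₂
  generalize ℓ₁.map (Int.cast : ℤ → ℚ_[p]) = A₁ at *
  generalize ℓ₂.map (Int.cast : ℤ → ℚ_[p]) = A₂ at *
  by_cases hn2 : m + 2 ≤ n
  · exact Or.inr (Or.inr hn2)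
  by_cases hn : n = m
  · left
    subst hn
    have u₁ : IsUnit S₁.det := by
      rw [isUnit_iff_ne_zero]; intro h0
      apply d₁; rw [← hS₁, det_mul, h0, mul_zero]
    have u₂ : IsUnit S₂.det := by
      rw [isUnit_iff_ne_zero]; intro h0
      apply d₂; rw [← hS₂, det_mul, h0, mul_zero]
    refine ⟨S₁⁻¹ * S₂, ?_, ?_⟩
    · rw [det_mul]; exact (Matrix.isUnit_nonsing_inv_det _ u₁).mul u₂
    · have h3 : S₁ * (S₁⁻¹ * S₂) = S₂ := by
        rw [← Matrix.mul_assoc, Matrix.mul_nonsing_inv _ u₁, Matrix.one_mul]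
      calc (S₁⁻¹ * S₂)ᵀ * A₁ * (S₁⁻¹ * S₂)
          = (S₁ * (S₁⁻¹ * S₂))ᵀ * V * (S₁ * (S₁⁻¹ * S₂)) := by
            rw [← hS₁, transpose_mul S₁]; simp only [Matrix.mul_assoc]
        _ = A₂ := by rw [h3, hS₂]
  obtain rfl : n = m + 1 := by omega
  by_cases hsq : IsSquare ((ℓ₁.det * ℓ₂.det : ℤ) : ℚ_[p])
  swap
  · exact Or.inr (Or.inl ⟨hsq, rfl⟩)
  left
  obtain ⟨z₁, q₁, r₁, hq₁, hr₁, hz₁, e₁, o₁, k₁⟩ := compl_vec V hV hd S₁ _ d₁ hS₁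
  obtain ⟨z₂, q₂, r₂, hq₂, hr₂, hz₂, e₂, o₂, k₂⟩ := compl_vec V hV hd S₂ _ d₂ hS₂
  obtain ⟨t, ht⟩ := hsq
  rw [Int.cast_mul, ← m₁, ← m₂] at ht
  obtain ⟨c, hc⟩ : ∃ c : ℚ_[p], c ^ 2 * q₁ = q₂ := by
    refine ⟨r₂ * t / (r₁ * A₂.det), ?_⟩
    rw [div_pow, div_mul_eq_mul_div, div_eq_iff (by positivity)]
    linear_combination (-r₂ ^ 2 * q₁) * ht - A₂.det * r₂ ^ 2 * e₁ + A₂.det * r₁ ^ 2 * e₂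
  have hc0 : c ≠ 0 := by
    rintro rfl; apply hq₂; rw [← hc]; ring
  have hB := toBilin_symm V hV
  have hyy : Matrix.toBilin' V (c • z₁) (c • z₁) = q₂ := by
    simp only [map_smul, LinearMap.smul_apply, smul_eq_mul, hz₁]; rw [← hc]; ring
  obtain ⟨σ, hσ, hσz, -⟩ := witt1 (Matrix.toBilin' V) hB z₂ (c • z₁) (by rw [hyy, hz₂]) (by rwa [hyy])
  have hk : ∀ j, ∃ u : Fin m → ℚ_[p], σ (S₂ᵀ j) = S₁ *ᵥ u := fun j => by
    apply k₁
    have := hσ (S₂ᵀ j) z₂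
    rw [o₂, hσz, map_smul, smul_eq_mul] at this
    exact (mul_eq_zero.1 this).resolve_left hc0
  choose u hu using hk
  let U : Matrix (Fin m) (Fin m) ℚ_[p] := Matrix.of fun i j => u j i
  have hcol : ∀ j, (S₁ * U)ᵀ j = σ (S₂ᵀ j) := fun j => by
    rw [hu]; rfl
  have hU : Uᵀ * A₁ * U = A₂ := by
    calc Uᵀ * A₁ * U = (S₁ * U)ᵀ * V * (S₁ * U) := by
          rw [← hS₁, transpose_mul S₁]; simp only [Matrix.mul_assoc]
      _ = A₂ := by
          ext i j
          rw [entry, hcol, hcol, hσ, ← entry, hS₂]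
  refine ⟨U, ?_, hU⟩
  rw [isUnit_iff_ne_zero]
  intro h0
  apply d₂
  rw [← hU, det_mul, h0, mul_zero]

end Bur

/-- For even positive definite forms ℓ₁, ℓ₂ of rank m and a prime p: buried in rank n
over ℤ_p ↔ buried in rank n over ℚ_p ↔ (ℓ₁ ≃ ℓ₂ over ℚ_p, or det ℓ₁ · det ℓ₂ is a
nonsquare in ℚ_p and n = m + 1, or n ≥ m + 2). -/
theorem buried_local_equivalences (p : ℕ) [Fact p.Prime] (m n : ℕ)
    (hm : 0 < m) (hmn : m ≤ n)
    (ℓ₁ ℓ₂ : Matrix (Fin m) (Fin m) ℤ)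
    (h₁ : IsPDForm ℓ₁) (h₂ : IsPDForm ℓ₂)
    (he₁ : IsEvenForm ℓ₁) (he₂ : IsEvenForm ℓ₂) :
    (BuriedIn ℤ_[p] n ℓ₁ ℓ₂ ↔ BuriedIn ℚ_[p] n ℓ₁ ℓ₂) ∧
    (BuriedIn ℚ_[p] n ℓ₁ ℓ₂ ↔
      ((∃ U : Matrix (Fin m) (Fin m) ℚ_[p], IsUnit U.det ∧
          Uᵀ * ℓ₁.map (Int.cast : ℤ → ℚ_[p]) * U = ℓ₂.map (Int.cast : ℤ → ℚ_[p])) ∨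
        (¬ IsSquare ((ℓ₁.det * ℓ₂.det : ℤ) : ℚ_[p]) ∧ n = m + 1) ∨
        m + 2 ≤ n)) := by
  exact ⟨⟨Bur.dir12, Bur.dir21 he₁ he₂⟩, ⟨Bur.dir23 hmn h₁ h₂, Bur.dir32 hm hmn h₁ h₂⟩⟩
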